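/- Let V and W be right O-comodules, regarded also as right L-comodules by restriction, and equip W ⊗_k A with the diagonal right O-coaction w ⊗ a ↦ Σ w₍₀₎ ⊗ a₍₁₎ ⊗ w₍₁₎a₍₂₎. Then the assignment F ↦ (id_W ⊗ ε) ∘ F is a bijection from the set of O-colinear maps V → W ⊗_k A onto the set of L-colinear maps V → W, natural in V and W. -/

import Mathlib

open TensorProduct

namespace PaperQuotient

variable {k : Type} [Field k]

section Comod

variable (k) (O : Type) [AddCommGroup O] [Module k O] [Coalgebra k O]

/-- The axioms of a right `O`-comodule structure on `V` given by the coaction `ρ`. -/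
structure IsComod {V : Type} [AddCommGroup V] [Module k V]
    (ρ : V →ₗ[k] V ⊗[k] O) : Prop where
  coassoc : ∀ v : V,
    (TensorProduct.assoc k V O O) ((TensorProduct.map ρ (LinearMap.id : O →ₗ[k] O)) (ρ v)) =
      (TensorProduct.map (LinearMap.id : V →ₗ[k] V) (Coalgebra.comul (R := k))) (ρ v)
  counit : ∀ v : V,
    (TensorProduct.rid k V)
      ((TensorProduct.map (LinearMap.id : V →ₗ[k] V) (Coalgebra.counit (R := k))) (ρ v)) = v

/-- `f : V → W` is colinear with respect to the coactions `ρV` and `ρW`. -/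
def IsColinear {V W : Type} [AddCommGroup V] [Module k V] [AddCommGroup W] [Module k W]
    (ρV : V →ₗ[k] V ⊗[k] O) (ρW : W →ₗ[k] W ⊗[k] O) (f : V →ₗ[k] W) : Prop :=
  ∀ v : V, ρW (f v) = (TensorProduct.map f (LinearMap.id : O →ₗ[k] O)) (ρV v)

/-- The map `id ⊗ ε : V ⊗ O → V`. -/
noncomputable def counitMap {V : Type} [AddCommGroup V] [Module k V] :
    V ⊗[k] O →ₗ[k] V :=
  (TensorProduct.rid k V).toLinearMap ∘ₗ
    TensorProduct.map (LinearMap.id : V →ₗ[k] V) (Coalgebra.counit (R := k))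

/-- The "free" right coaction `id_V ⊗ Δ` on `V ⊗ O`. -/
noncomputable def freeCoact {V : Type} [AddCommGroup V] [Module k V] :
    V ⊗[k] O →ₗ[k] (V ⊗[k] O) ⊗[k] O :=
  (TensorProduct.assoc k V O O).symm.toLinearMap ∘ₗ
    LinearMap.lTensor V (Coalgebra.comul (R := k))

end Comod

section CotensorDef

variable (k)
variable {O : Type} [AddCommGroup O] [Module k O] [Coalgebra k O]
variable {L : Type} [AddCommGroup L] [Module k L]

/-- The difference of the two maps `U ⊗ O → U ⊗ (L ⊗ O)` whose equalizer is the
cotensor product `U □_L O`; here `ql : O → L` is the (linear) quotient map. -/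
noncomputable def cotensorObstruction (ql : O →ₗ[k] L)
    {U : Type} [AddCommGroup U] [Module k U] (ρU : U →ₗ[k] U ⊗[k] L) :
    U ⊗[k] O →ₗ[k] U ⊗[k] (L ⊗[k] O) :=
  (TensorProduct.assoc k U L O).toLinearMap ∘ₗ
      (TensorProduct.map ρU (LinearMap.id : O →ₗ[k] O))
    - TensorProduct.map (LinearMap.id : U →ₗ[k] U)
        ((TensorProduct.map ql (LinearMap.id : O →ₗ[k] O)) ∘ₗ Coalgebra.comul (R := k))

/-- The cotensor product `U □_L O` as a subspace of `U ⊗ O`. -/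
noncomputable def cotensor (ql : O →ₗ[k] L)
    {U : Type} [AddCommGroup U] [Module k U] (ρU : U →ₗ[k] U ⊗[k] L) :
    Submodule k (U ⊗[k] O) :=
  LinearMap.ker (cotensorObstruction k ql ρU)

end CotensorDef

section HopfSetup

variable (k)
variable (O : Type) [CommRing O] [HopfAlgebra k O]

/-- `A` is a Hopf subalgebra of `O`: it is closed under comultiplication and antipode. -/
structure IsHopfSub (A : Subalgebra k O) : Prop where
  comul_mem : ∀ a ∈ A, Coalgebra.comul (R := k) a ∈
    Submodule.span k {x : O ⊗[k] O | ∃ b ∈ A, ∃ c ∈ A, x = b ⊗ₜ[k] c}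
  antipode_mem : ∀ a ∈ A, HopfAlgebra.antipode (R := k) a ∈ A

/-- The set of elements of the augmentation ideal `A⁺ = A ∩ ker ε` of `A`. -/
def augSet (A : Subalgebra k O) : Set O :=
  {a : O | a ∈ A ∧ Coalgebra.counit (R := k) a = 0}

variable (L : Type) [CommRing L] [HopfAlgebra k L]

/-- `q : O → L` realizes `L` as the quotient Hopf algebra `O ⊗_A k = O/(A⁺O)`. -/
structure IsQuotientHopf (A : Subalgebra k O) (q : O →ₐc[k] L) : Prop where
  surj : Function.Surjective q
  ker : RingHom.ker (q : O →ₐ[k] L) = Ideal.span (augSet k O A)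

/-- The coaction of `L` on an `O`-comodule obtained by restriction along `q`. -/
noncomputable def resCoact (q : O →ₐc[k] L) {V : Type} [AddCommGroup V] [Module k V]
    (ρV : V →ₗ[k] V ⊗[k] O) : V →ₗ[k] V ⊗[k] L :=
  (LinearMap.lTensor V (q : O →ₗ[k] L)) ∘ₗ ρV

/-- The multiplication map `(U ⊗ O) ⊗ O → U ⊗ O`, `(u ⊗ g) ⊗ h ↦ u ⊗ gh`. -/
noncomputable def multMap (U : Type) [AddCommGroup U] [Module k U] :
    (U ⊗[k] O) ⊗[k] O →ₗ[k] U ⊗[k] O :=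
  (LinearMap.lTensor U (LinearMap.mul' k O)) ∘ₗ (TensorProduct.assoc k U O O).toLinearMap

/-- The diagonal coaction on the tensor product of two comodules. -/
noncomputable def tensorCoact {X Y : Type} [AddCommGroup X] [Module k X]
    [AddCommGroup Y] [Module k Y]
    (ρX : X →ₗ[k] X ⊗[k] O) (ρY : Y →ₗ[k] Y ⊗[k] O) :
    X ⊗[k] Y →ₗ[k] (X ⊗[k] Y) ⊗[k] O :=
  (TensorProduct.map (LinearMap.id : X ⊗[k] Y →ₗ[k] X ⊗[k] Y) (LinearMap.mul' k O)) ∘ₗ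
    (TensorProduct.tensorTensorTensorComm k X O Y O).toLinearMap ∘ₗ
      (TensorProduct.map ρX ρY)

/-- The diagonal coaction on `X ⊗ O`, `x ⊗ a ↦ Σ (x₀ ⊗ a₁) ⊗ x₁a₂`. -/
noncomputable def diagCoact {X : Type} [AddCommGroup X] [Module k X]
    (ρX : X →ₗ[k] X ⊗[k] O) :
    X ⊗[k] O →ₗ[k] (X ⊗[k] O) ⊗[k] O :=
  tensorCoact k O ρX (Coalgebra.comul (R := k))

end HopfSetup

end PaperQuotient

namespace PaperQuotient

/-- A bundled right `O`-comodule. -/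
structure Comod (k O : Type) [Field k] [AddCommGroup O] [Module k O] [Coalgebra k O] where
  carrier : Type
  [acg : AddCommGroup carrier]
  [mod : Module k carrier]
  ρ : carrier →ₗ[k] carrier ⊗[k] O
  comod : IsComod k O ρ

attribute [instance] Comod.acg Comod.mod

end PaperQuotient

namespace PaperQuotient

section Twist

variable {k : Type} [Field k] {O : Type} [CommRing O] [HopfAlgebra k O]
variable {W : Type} [AddCommGroup W] [Module k W]
variable {C : Type} [CommRing C] [Algebra k C]

/-- The `C`-linear endomorphism `w ⊗ c ↦ w₀ ⊗ γ(w₁) c` of `W ⊗ C`. -/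
noncomputable def twist (ρ : W →ₗ[k] W ⊗[k] O) (γ : O →ₗ[k] C) : W ⊗[k] C →ₗ[k] W ⊗[k] C :=
  LinearMap.lTensor W (LinearMap.mul' k C) ∘ₗ (TensorProduct.assoc k W C C).toLinearMap ∘ₗ
    LinearMap.rTensor C (LinearMap.lTensor W γ ∘ₗ ρ)

theorem twist_tmul (ρ : W →ₗ[k] W ⊗[k] O) (γ : O →ₗ[k] C) (w : W) (c : C) :
    twist ρ γ (w ⊗ₜ c) = LinearMap.lTensor W (LinearMap.mulRight k c ∘ₗ γ) (ρ w) := by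
  simp only [twist, LinearMap.comp_apply, LinearMap.rTensor_tmul]
  induction ρ w using TensorProduct.induction_on with
  | zero => simp
  | tmul x y => simp
  | add x y hx hy => simp only [map_add, TensorProduct.add_tmul, hx, hy]

theorem twist_twist {ρ : W →ₗ[k] W ⊗[k] O} (hρ : IsComod k O ρ) {γ γ' γ'' : O →ₗ[k] C}
    (h : LinearMap.mul' k C ∘ₗ TensorProduct.map γ' γ ∘ₗ Coalgebra.comul = γ'') :
    twist ρ γ' ∘ₗ twist ρ γ = twist ρ γ'' := by
  subst h
  ext w c
  have key : ∀ z : W ⊗[k] O,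
      twist ρ γ' (LinearMap.lTensor W (LinearMap.mulRight k c ∘ₗ γ) z) =
      LinearMap.lTensor W (LinearMap.mulRight k c ∘ₗ LinearMap.mul' k C ∘ₗ TensorProduct.map γ' γ)
        (TensorProduct.assoc k W O O (TensorProduct.map ρ LinearMap.id z)) := by
    intro z
    induction z using TensorProduct.induction_on with
    | zero => simp
    | add x y hx hy => simp only [map_add, hx, hy]
    | tmul u h =>
      simp only [LinearMap.lTensor_tmul, twist_tmul, TensorProduct.map_tmul, LinearMap.id_apply]
      induction ρ u using TensorProduct.induction_on with
      | zero => simp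
      | add x y hx hy => simp only [map_add, TensorProduct.add_tmul, hx, hy]
      | tmul x y => simp [mul_assoc]
  simp only [TensorProduct.AlgebraTensorModule.curry_apply, LinearMap.restrictScalars_self,
    TensorProduct.curry_apply, LinearMap.comp_apply]
  rw [twist_tmul, key, hρ.coassoc, twist_tmul]
  exact (LinearMap.lTensor_comp_apply W _ _ _).symm

theorem twist_counit {ρ : W →ₗ[k] W ⊗[k] O} (hρ : IsComod k O ρ) :
    twist ρ (Algebra.linearMap k C ∘ₗ Coalgebra.counit) = LinearMap.id := by
  ext w c
  simp only [TensorProduct.AlgebraTensorModule.curry_apply, LinearMap.restrictScalars_self,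
    TensorProduct.curry_apply, twist_tmul, LinearMap.id_apply]
  have h := hρ.counit w
  conv_rhs => rw [← h]
  induction ρ w using TensorProduct.induction_on with
  | zero => simp
  | add x y hx hy => simp only [map_add, TensorProduct.add_tmul, hx, hy]
  | tmul x y => simp [TensorProduct.smul_tmul, Algebra.smul_def]

theorem mul_map_antipode_left (γ : O →ₐ[k] C) :
    LinearMap.mul' k C ∘ₗ TensorProduct.map (γ.toLinearMap ∘ₗ HopfAlgebra.antipode k)
      γ.toLinearMap ∘ₗ Coalgebra.comul = Algebra.linearMap k C ∘ₗ Coalgebra.counit := by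
  have h : LinearMap.mul' k C ∘ₗ TensorProduct.map (γ.toLinearMap ∘ₗ HopfAlgebra.antipode k)
      γ.toLinearMap = γ.toLinearMap ∘ₗ LinearMap.mul' k O ∘ₗ
        (HopfAlgebra.antipode k).rTensor O := by
    ext x y
    simp
  rw [← LinearMap.comp_assoc, h]
  ext x
  simp

theorem mul_map_antipode_right (γ : O →ₐ[k] C) :
    LinearMap.mul' k C ∘ₗ TensorProduct.map γ.toLinearMap
      (γ.toLinearMap ∘ₗ HopfAlgebra.antipode k) ∘ₗ Coalgebra.comul =
      Algebra.linearMap k C ∘ₗ Coalgebra.counit := by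
  have h : LinearMap.mul' k C ∘ₗ TensorProduct.map γ.toLinearMap
      (γ.toLinearMap ∘ₗ HopfAlgebra.antipode k) = γ.toLinearMap ∘ₗ LinearMap.mul' k O ∘ₗ
        (HopfAlgebra.antipode k).lTensor O := by
    ext x y
    simp
  rw [← LinearMap.comp_assoc, h]
  ext x
  simp

theorem twist_antipode_twist {ρ : W →ₗ[k] W ⊗[k] O} (hρ : IsComod k O ρ) (γ : O →ₐ[k] C)
    (z : W ⊗[k] C) :
    twist ρ (γ.toLinearMap ∘ₗ HopfAlgebra.antipode k) (twist ρ γ.toLinearMap z) = z := by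
  rw [← LinearMap.comp_apply, twist_twist hρ (mul_map_antipode_left γ), twist_counit hρ,
    LinearMap.id_apply]

theorem twist_twist_antipode {ρ : W →ₗ[k] W ⊗[k] O} (hρ : IsComod k O ρ) (γ : O →ₐ[k] C)
    (z : W ⊗[k] C) :
    twist ρ γ.toLinearMap (twist ρ (γ.toLinearMap ∘ₗ HopfAlgebra.antipode k) z) = z := by
  rw [← LinearMap.comp_apply, twist_twist hρ (mul_map_antipode_right γ), twist_counit hρ,
    LinearMap.id_apply]

theorem twist_injective {ρ : W →ₗ[k] W ⊗[k] O} (hρ : IsComod k O ρ) (γ : O →ₐ[k] C) :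
    Function.Injective (twist ρ γ.toLinearMap) :=
  Function.LeftInverse.injective (twist_antipode_twist hρ γ)

theorem twist_surjective {ρ : W →ₗ[k] W ⊗[k] O} (hρ : IsComod k O ρ) (γ : O →ₐ[k] C) :
    Function.Surjective (twist ρ γ.toLinearMap) :=
  Function.RightInverse.surjective (twist_twist_antipode hρ γ)

end Twist

section Convolve

variable {k : Type} [Field k] {O : Type} [CommRing O] [HopfAlgebra k O]
variable {N : Type} [AddCommGroup N] [Module k N]
variable {F : Type} [CommRing F] [Algebra k F]

/-- The convolution `n ↦ f(n₀) β(n₁)` of a functional `f` on a comodule with `β : O → F`. -/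
noncomputable def convolve (ρ : N →ₗ[k] N ⊗[k] O) (β : O →ₗ[k] F) (f : N →ₗ[k] F) : N →ₗ[k] F :=
  LinearMap.mul' k F ∘ₗ TensorProduct.map f β ∘ₗ ρ

theorem convolve_add (ρ : N →ₗ[k] N ⊗[k] O) (β : O →ₗ[k] F) (f f' : N →ₗ[k] F) :
    convolve ρ β (f + f') = convolve ρ β f + convolve ρ β f' := by
  ext n
  simp [convolve, TensorProduct.map_add_left]

theorem convolve_smul (ρ : N →ₗ[k] N ⊗[k] O) (β : O →ₗ[k] F) (c : F) (f : N →ₗ[k] F) :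
    convolve ρ β (c • f) = c • convolve ρ β f := by
  ext n
  simp only [convolve, LinearMap.comp_apply, LinearMap.smul_apply]
  induction ρ n using TensorProduct.induction_on with
  | zero => simp
  | add x y hx hy => simp only [map_add, hx, hy, smul_add]
  | tmul x y => simp [mul_assoc]

theorem mul_map_twist (ρ : N →ₗ[k] N ⊗[k] O) (β : O →ₗ[k] F) (f : N →ₗ[k] F) (z : N ⊗[k] F) :
    LinearMap.mul' k F (TensorProduct.map f LinearMap.id (twist ρ β z)) =
      LinearMap.mul' k F (TensorProduct.map (convolve ρ β f) LinearMap.id z) := by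
  induction z using TensorProduct.induction_on with
  | zero => simp
  | add x y hx hy => simp only [map_add, hx, hy]
  | tmul n c =>
    rw [twist_tmul]
    simp only [convolve, TensorProduct.map_tmul, LinearMap.comp_apply]
    induction ρ n using TensorProduct.induction_on with
    | zero => simp
    | add x y hx hy => simp only [map_add, TensorProduct.add_tmul, hx, hy]
    | tmul x y => simp [mul_assoc]

theorem convolve_antipode_convolve {ρ : N →ₗ[k] N ⊗[k] O} (hρ : IsComod k O ρ) (β : O →ₐ[k] F)
    (f : N →ₗ[k] F) :
    convolve ρ (β.comp (HopfAlgebra.antipodeAlgHom k O)).toLinearMap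
      (convolve ρ β.toLinearMap f) = f := by
  ext n
  have h1 := mul_map_twist ρ (β.comp (HopfAlgebra.antipodeAlgHom k O)).toLinearMap
    (convolve ρ β.toLinearMap f) (n ⊗ₜ 1)
  rw [← mul_map_twist] at h1
  have h2 := twist_twist_antipode hρ β (n ⊗ₜ 1)
  rw [AlgHom.comp_toLinearMap, HopfAlgebra.toLinearMap_antipodeAlgHom, h2] at h1
  simpa using h1.symm

theorem convolve_injective {ρ : N →ₗ[k] N ⊗[k] O} (hρ : IsComod k O ρ) (β : O →ₐ[k] F) :
    Function.Injective (convolve ρ β.toLinearMap) :=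
  Function.LeftInverse.injective (convolve_antipode_convolve hρ β)

end Convolve

section HopfModule

variable {k : Type} [Field k] {O : Type} [CommRing O] [HopfAlgebra k O]
variable {A : Type} [CommRing A] [HopfAlgebra k A]
variable {N : Type} [AddCommGroup N] [Module k N] [Module A N] [IsScalarTower k A N]

/-- The action of `A ⊗ A` on `N ⊗ O`, where the second factor acts through `i : A → O`. -/
noncomputable def tensorAct (i : A →ₗ[k] O) : A ⊗[k] A →ₗ[k] N ⊗[k] O →ₗ[k] N ⊗[k] O :=
  TensorProduct.homTensorHomMap (RingHom.id k) N O N O ∘ₗ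
    TensorProduct.map (Algebra.lsmul k k N).toLinearMap (LinearMap.mul k O ∘ₗ i)

@[simp]
theorem tensorAct_tmul (i : A →ₗ[k] O) (a b : A) (n : N) (x : O) :
    tensorAct i (a ⊗ₜ b) (n ⊗ₜ x) = (a • n) ⊗ₜ[k] (i b * x) := by
  simp [tensorAct]

/-- `N` with coaction `ρ` is a relative Hopf module: `ρ (a n) = a₁ n₀ ⊗ i(a₂) n₁`. -/
structure IsHopfModule (i : A →ₗ[k] O) (ρ : N →ₗ[k] N ⊗[k] O) : Prop where
  comod : IsComod k O ρ
  smul : ∀ (a : A) (n : N), ρ (a • n) = tensorAct i (Coalgebra.comul (R := k) a) (ρ n)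

/-- The right coaction of `O` on `A` obtained from a map `A → O`. -/
noncomputable def coactOf (i : A →ₗ[k] O) : A →ₗ[k] A ⊗[k] O :=
  LinearMap.lTensor A i ∘ₗ Coalgebra.comul

theorem isComod_coactOf (i : A →ₐc[k] O) : IsComod k O (coactOf (i : A →ₗ[k] O)) where
  coassoc a := by
    have h1 : ∀ z : A ⊗[k] A, TensorProduct.assoc k A O O
        (TensorProduct.map (coactOf (i : A →ₗ[k] O)) LinearMap.id
          (LinearMap.lTensor A (i : A →ₗ[k] O) z)) =
        LinearMap.lTensor A (TensorProduct.map (i : A →ₗ[k] O) (i : A →ₗ[k] O))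
          (TensorProduct.assoc k A A A (LinearMap.rTensor A Coalgebra.comul z)) := by
      intro z
      induction z using TensorProduct.induction_on with
      | zero => simp
      | add x y hx hy => simp only [map_add, hx, hy]
      | tmul x y =>
        simp only [coactOf, LinearMap.lTensor_tmul, TensorProduct.map_tmul, LinearMap.comp_apply,
          LinearMap.rTensor_tmul]
        induction Coalgebra.comul (R := k) x using TensorProduct.induction_on with
        | zero => simp
        | add x y hx hy => simp only [map_add, TensorProduct.add_tmul, hx, hy]
        | tmul u v => simp
    have h2 : TensorProduct.map (i : A →ₗ[k] O) (i : A →ₗ[k] O) ∘ₗ Coalgebra.comul =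
        Coalgebra.comul ∘ₗ (i : A →ₗ[k] O) := CoalgHomClass.map_comp_comul i
    conv_lhs => rw [coactOf, LinearMap.comp_apply]
    rw [← coactOf, h1, Coalgebra.coassoc_apply, ← LinearMap.lTensor_comp_apply, h2,
      LinearMap.lTensor_comp_apply]
    rfl
  counit a := by
    have h : Coalgebra.counit ∘ₗ (i : A →ₗ[k] O) = Coalgebra.counit (R := k) :=
      CoalgHomClass.counit_comp i
    change TensorProduct.rid k A (LinearMap.lTensor A Coalgebra.counit
      (LinearMap.lTensor A (i : A →ₗ[k] O) (Coalgebra.comul a))) = a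
    rw [← LinearMap.lTensor_comp_apply, h, Coalgebra.lTensor_counit_comul]
    simp

variable {F : Type} [Field F] [Algebra k F]

/-- The `k`-linear functionals `f : N → F` which are semilinear along `g : A → F`. -/
def semiDual (N : Type) [AddCommGroup N] [Module k N] [Module A N] (g : A →ₗ[k] F) :
    Submodule F (N →ₗ[k] F) where
  carrier := {f | ∀ (a : A) (n : N), f (a • n) = g a * f n}
  zero_mem' := by simp
  add_mem' hf hf' a n := by simp [hf a n, hf' a n, mul_add]
  smul_mem' c f hf a n := by simp [hf a n, mul_left_comm]

omit [IsScalarTower k A N] in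
theorem finite_semiDual [Module.Finite A N] (g : A →ₗ[k] F) :
    Module.Finite F (semiDual N g) := by
  obtain ⟨s, hs⟩ := Module.Finite.fg_top (R := A) (M := N)
  let e : semiDual N g →ₗ[F] (s → F) :=
    { toFun := fun f x => f.1 x.1
      map_add' := fun _ _ => rfl
      map_smul' := fun _ _ => rfl }
  refine Module.Finite.of_injective e fun f f' h => ?_
  refine Subtype.ext (LinearMap.ext fun n => ?_)
  have hn : n ∈ Submodule.span A (s : Set N) := hs ▸ Submodule.mem_top
  induction hn using Submodule.span_induction with
  | mem x hx => exact congrFun h ⟨x, hx⟩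
  | zero => simp
  | add x y _ _ hx hy => rw [map_add, map_add, hx, hy]
  | smul a x _ hx => rw [f.2 a x, f'.2 a x, hx]

theorem convolve_mem_semiDual {i : A →ₗ[k] O} {ρ : N →ₗ[k] N ⊗[k] O} (hρ : IsHopfModule i ρ)
    (g : A →ₗ[k] F) (β : O →ₐ[k] F) {f : N →ₗ[k] F} (hf : f ∈ semiDual N g) :
    convolve ρ β.toLinearMap f ∈ semiDual N (convolve (coactOf i) β.toLinearMap g) := by
  intro a n
  simp only [convolve, LinearMap.comp_apply, hρ.smul, coactOf]
  generalize ρ n = z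
  generalize Coalgebra.comul (R := k) a = y
  induction y using TensorProduct.induction_on with
  | zero => simp
  | add x y hx hy => simp only [map_add, LinearMap.add_apply, hx, hy, add_mul]
  | tmul a b =>
    induction z using TensorProduct.induction_on with
    | zero => simp
    | add x y hx hy => simp only [map_add, hx, hy, mul_add]
    | tmul n x =>
      simp [hf a n]
      ring

theorem finrank_semiDual_le [Module.Finite A N] {i : A →ₗ[k] O} {ρ : N →ₗ[k] N ⊗[k] O}
    (hρ : IsHopfModule i ρ) (g : A →ₗ[k] F) (β : O →ₐ[k] F) :
    Module.finrank F (semiDual N g) ≤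
      Module.finrank F (semiDual N (convolve (coactOf i) β.toLinearMap g)) := by
  have := finite_semiDual (N := N) (convolve (coactOf i) β.toLinearMap g)
  let e : semiDual N g →ₗ[F] semiDual N (convolve (coactOf i) β.toLinearMap g) :=
    { toFun := fun f => ⟨convolve ρ β.toLinearMap f.1, convolve_mem_semiDual hρ g β f.2⟩
      map_add' := fun f f' => Subtype.ext (convolve_add _ _ f.1 f'.1)
      map_smul' := fun c f => Subtype.ext (convolve_smul _ _ c f.1) }
  refine LinearMap.finrank_le_finrank_of_injective (f := e) fun f f' h => ?_
  exact Subtype.ext (convolve_injective hρ.comod β (congrArg Subtype.val h))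

end HopfModule

/-- Two points of spectra with the same image are dominated by a common field-valued point. -/
theorem exists_field_algHom_comp_eq {k A B C : Type} [Field k] [CommRing A] [CommRing B]
    [CommRing C] [Algebra k A] [Algebra k B] [Algebra k C] (u : A →ₐ[k] B) (w : A →ₐ[k] C)
    (I : Ideal B) [I.IsPrime] (J : Ideal C) [J.IsPrime] (h : I.comap u = J.comap w) :
    ∃ (F : Type) (_ : Field F) (_ : Algebra k F) (b : B →ₐ[k] F) (c : C →ₐ[k] F),
      ∀ a, b (u a) = c (w a) := by
  let p := I.comap u
  let := (Ideal.ResidueField.map p I u.toRingHom rfl).toAlgebra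
  let := (Ideal.ResidueField.map p J w.toRingHom h).toAlgebra
  obtain ⟨m, hm⟩ := Ideal.exists_maximal (I.ResidueField ⊗[p.ResidueField] J.ResidueField)
  let F := (I.ResidueField ⊗[p.ResidueField] J.ResidueField) ⧸ m
  let : Field F := Ideal.Quotient.field m
  let b : B →+* F := (Ideal.Quotient.mk m).comp
    (Algebra.TensorProduct.includeLeftRingHom.comp (algebraMap B I.ResidueField))
  let c : C →+* F := (Ideal.Quotient.mk m).comp
    ((Algebra.TensorProduct.includeRight (R := p.ResidueField)
      (A := I.ResidueField)).toRingHom.comp (algebraMap C J.ResidueField))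
  have hbc : ∀ a, b (u a) = c (w a) := by
    intro a
    have h1 : algebraMap B I.ResidueField (u a) =
        algebraMap p.ResidueField I.ResidueField (algebraMap A p.ResidueField a) :=
      (Ideal.ResidueField.map_algebraMap p I u.toRingHom rfl a).symm
    have h2 : algebraMap C J.ResidueField (w a) =
        algebraMap p.ResidueField J.ResidueField (algebraMap A p.ResidueField a) :=
      (Ideal.ResidueField.map_algebraMap p J w.toRingHom h a).symm
    simp only [b, c, RingHom.comp_apply, h1, h2]
    congr 1
    simp [Algebra.algebraMap_eq_smul_one, TensorProduct.smul_tmul]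
  let : Algebra k F := (b.comp (algebraMap k B)).toAlgebra
  refine ⟨F, inferInstance, inferInstance, { b with commutes' := fun r => rfl },
    { c with commutes' := fun r => ?_ }, hbc⟩
  have := hbc (algebraMap k A r)
  rw [AlgHom.commutes, AlgHom.commutes] at this
  exact this.symm

/-- Injective algebra maps out of a nontrivial algebra share a common field-valued point. -/
theorem exists_field_algHom_comp_eq_of_injective {k A B C : Type} [Field k] [CommRing A]
    [Nontrivial A] [CommRing B] [CommRing C] [Algebra k A] [Algebra k B] [Algebra k C]
    (u : A →ₐ[k] B) (w : A →ₐ[k] C) (hu : Function.Injective u) (hw : Function.Injective w) :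
    ∃ (F : Type) (_ : Field F) (_ : Algebra k F) (b : B →ₐ[k] F) (c : C →ₐ[k] F),
      ∀ a, b (u a) = c (w a) := by
  obtain ⟨m, hm⟩ := Ideal.exists_maximal A
  obtain ⟨p, hp, -⟩ := Ideal.exists_minimalPrimes_le (bot_le : ⊥ ≤ m)
  obtain ⟨I, hI, hIp⟩ := Ideal.exists_comap_eq_of_mem_minimalPrimes_of_injective
    (f := (u : A →+* B)) hu p hp
  obtain ⟨J, hJ, hJp⟩ := Ideal.exists_comap_eq_of_mem_minimalPrimes_of_injective
    (f := (w : A →+* C)) hw p hp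
  exact exists_field_algHom_comp_eq u w I J (hIp.trans hJp.symm)

section

variable {k : Type} [Field k] {O : Type} [CommRing O] [HopfAlgebra k O]
variable {A : Type} [CommRing A] [HopfAlgebra k A]

/-- The translate `a ↦ g(a₁) ⊗ i(a₂)` of `i : A → O` by a `K`-valued point `g`. -/
noncomputable def translate {K : Type} [CommRing K] [Algebra k K] (g : A →ₐ[k] K)
    (i : A →ₐ[k] O) : A →ₐ[k] K ⊗[k] O :=
  (Algebra.TensorProduct.map g i).comp (Bialgebra.comulAlgHom k A)

theorem translate_apply {K : Type} [CommRing K] [Algebra k K] (g : A →ₐ[k] K)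
    (i : A →ₐ[k] O) (a : A) : translate g i a =
      TensorProduct.map g.toLinearMap i.toLinearMap (Coalgebra.comul (R := k) a) :=
  rfl

theorem translate_injective {K : Type} [Field K] [Algebra k K] (g : A →ₐ[k] K)
    (i : A →ₐ[k] O) (hi : Function.Injective i) : Function.Injective (translate g i) := by
  refine (injective_iff_map_eq_zero _).2 fun a ha => ?_
  rw [translate_apply] at ha
  have h1 : TensorProduct.map g.toLinearMap LinearMap.id (Coalgebra.comul (R := k) a) = 0 := by
    refine (Module.Flat.lTensor_preserves_injective_linearMap (M := K) i.toLinearMap hi) ?_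
    rw [map_zero, ← ha, LinearMap.lTensor, ← LinearMap.comp_apply, ← TensorProduct.map_comp]
    rfl
  let t : K ⊗[k] A →ₗ[k] K ⊗[k] A :=
    LinearMap.rTensor A (LinearMap.mul' k K) ∘ₗ (TensorProduct.assoc k K K A).symm.toLinearMap ∘ₗ
      LinearMap.lTensor K (LinearMap.rTensor A (g.toLinearMap ∘ₗ HopfAlgebra.antipode k) ∘ₗ
        Coalgebra.comul)
  have h2 : ∀ z : A ⊗[k] A, t (TensorProduct.map g.toLinearMap LinearMap.id z) =
      LinearMap.rTensor A (g.toLinearMap ∘ₗ LinearMap.mul' k A ∘ₗ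
        LinearMap.lTensor A (HopfAlgebra.antipode k))
        ((TensorProduct.assoc k A A A).symm (LinearMap.lTensor A Coalgebra.comul z)) := by
    intro z
    induction z using TensorProduct.induction_on with
    | zero => simp
    | add x y hx hy => simp only [map_add, hx, hy]
    | tmul x y =>
      simp only [t, TensorProduct.map_tmul, LinearMap.comp_apply, LinearMap.lTensor_tmul]
      induction Coalgebra.comul (R := k) y using TensorProduct.induction_on with
      | zero => simp
      | add x y hx hy => simp only [map_add, TensorProduct.tmul_add, hx, hy]
      | tmul u v => simp
  have h3 := h2 (Coalgebra.comul a)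
  have h4 : (g.toLinearMap ∘ₗ LinearMap.mul' k A ∘ₗ
      LinearMap.lTensor A (HopfAlgebra.antipode k)) ∘ₗ Coalgebra.comul =
      (g.toLinearMap ∘ₗ Algebra.linearMap k A) ∘ₗ Coalgebra.counit := by
    ext x
    simp
  rw [h1, map_zero, Coalgebra.coassoc_symm_apply, ← LinearMap.rTensor_comp_apply, h4,
    LinearMap.rTensor_comp_apply, Coalgebra.rTensor_counit_comul] at h3
  refine Algebra.TensorProduct.includeRight_injective (R := k) (A := K) (B := A)
    (algebraMap k K).injective ?_
  simpa using h3.symm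

theorem convolve_comp_coactOf {F : Type} [CommRing F] [Algebra k F] {K : Type} [Field K]
    [Algebra k K] (i : A →ₐc[k] O) (g : A →ₐ[k] K) (v : K →ₐ[k] F) (β : O →ₐ[k] F)
    (b : K ⊗[k] O →ₐ[k] F) (hv : ∀ x, b (x ⊗ₜ 1) = v x) (hβ : ∀ x, b (1 ⊗ₜ x) = β x) (a : A) :
    convolve (coactOf (i : A →ₗ[k] O)) β.toLinearMap (v.toLinearMap ∘ₗ g.toLinearMap) a =
      b (translate g (i : A →ₐ[k] O) a) := by
  simp only [convolve, coactOf, LinearMap.comp_apply, translate_apply]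
  induction Coalgebra.comul (R := k) a using TensorProduct.induction_on with
  | zero => simp
  | add x y hx hy => simp only [map_add, hx, hy]
  | tmul x y => simp [← hv, ← hβ, ← map_mul]

theorem convolve_counit_coactOf {F : Type} [CommRing F] [Algebra k F] (i : A →ₐc[k] O)
    (β : O →ₐ[k] F) (a : A) :
    convolve (coactOf (i : A →ₗ[k] O)) β.toLinearMap
      (Algebra.linearMap k F ∘ₗ Coalgebra.counit) a = β (i a) := by
  have h : ∀ z : A ⊗[k] A, LinearMap.mul' k F (TensorProduct.map
      (Algebra.linearMap k F ∘ₗ Coalgebra.counit) β.toLinearMap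
        (LinearMap.lTensor A (i : A →ₗ[k] O) z)) =
      β (i (TensorProduct.lid k A (LinearMap.rTensor A Coalgebra.counit z))) := by
    intro z
    induction z using TensorProduct.induction_on with
    | zero => simp
    | add x y hx hy => simp only [map_add, hx, hy]
    | tmul x y => simp [← Algebra.smul_def]
  simp only [convolve, coactOf, LinearMap.comp_apply]
  rw [h, Coalgebra.rTensor_counit_comul]
  simp

/-- Every point of `Spec A` can be moved by field-valued points of `Spec O` to the identity. -/
theorem exists_field_convolve_eq {K : Type} [Field K] [Algebra k K] (g : A →ₐ[k] K)
    (i : A →ₐc[k] O) (hi : Function.Injective i) :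
    ∃ (F : Type) (_ : Field F) (_ : Algebra k F) (v : K →ₐ[k] F) (β β' : O →ₐ[k] F),
      convolve (coactOf (i : A →ₗ[k] O)) β.toLinearMap (v.toLinearMap ∘ₗ g.toLinearMap) =
        convolve (coactOf (i : A →ₗ[k] O)) β'.toLinearMap
          (Algebra.linearMap k F ∘ₗ Coalgebra.counit) := by
  have : Nontrivial A := g.toRingHom.domain_nontrivial
  obtain ⟨F, _, _, b, c, hbc⟩ :=
    exists_field_algHom_comp_eq_of_injective (translate g (i : A →ₐ[k] O)) (i : A →ₐ[k] O)
      (translate_injective g (i : A →ₐ[k] O) hi) hi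
  refine ⟨F, inferInstance, inferInstance, b.comp Algebra.TensorProduct.includeLeft,
    b.comp Algebra.TensorProduct.includeRight, c, LinearMap.ext fun a => ?_⟩
  rw [convolve_comp_coactOf i g _ _ b (fun _ => rfl) (fun _ => rfl), convolve_counit_coactOf]
  exact hbc a

end

section Coinvariants

variable (k : Type) [Field k] (A : Type) [CommRing A] [HopfAlgebra k A]
variable (N : Type) [AddCommGroup N] [Module k N] [Module A N] [IsScalarTower k A N]

/-- The subspace `A⁺N` of `N`. -/
def augSpan : Submodule k N :=
  Submodule.span k {x | ∃ (a : A) (n : N), Coalgebra.counit (R := k) a = 0 ∧ x = a • n}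

variable {k A N}

theorem mkQ_augSpan_smul (a : A) (n : N) :
    (augSpan k A N).mkQ (a • n) = Coalgebra.counit (R := k) a • (augSpan k A N).mkQ n := by
  rw [← map_smul, ← sub_eq_zero, ← map_sub, ← LinearMap.mem_ker, Submodule.ker_mkQ]
  refine Submodule.subset_span
    ⟨a - algebraMap k A (Coalgebra.counit a), n, by simp, ?_⟩
  rw [sub_smul, algebraMap_smul]

theorem finite_quotient_augSpan [Module.Finite A N] : Module.Finite k (N ⧸ augSpan k A N) := by
  classical
  obtain ⟨s, hs⟩ := Module.Finite.fg_top (R := A) (M := N)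
  refine ⟨⟨s.image (augSpan k A N).mkQ, ?_⟩⟩
  rw [eq_top_iff]
  rintro x -
  obtain ⟨n, rfl⟩ := (augSpan k A N).mkQ_surjective x
  have hn : n ∈ Submodule.span A (s : Set N) := hs ▸ Submodule.mem_top
  induction hn using Submodule.span_induction with
  | mem x hx => exact Submodule.subset_span (by simpa using ⟨x, hx, rfl⟩)
  | zero => simp
  | add x y _ _ hx hy => rw [map_add]; exact add_mem hx hy
  | smul a x _ hx => rw [mkQ_augSpan_smul]; exact Submodule.smul_mem _ _ hx

theorem finrank_semiDual_counit_le [Module.Finite A N] (F : Type) [Field F] [Algebra k F] :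
    Module.finrank F (semiDual N (Algebra.linearMap k F ∘ₗ Coalgebra.counit (A := A))) ≤
      Module.finrank k (N ⧸ augSpan k A N) := by
  have := finite_quotient_augSpan (k := k) (A := A) (N := N)
  have hle : ∀ f ∈ semiDual N (Algebra.linearMap k F ∘ₗ Coalgebra.counit (A := A)),
      augSpan k A N ≤ LinearMap.ker f := by
    intro f hf
    refine Submodule.span_le.2 ?_
    rintro x ⟨a, n, ha, rfl⟩
    simp [hf a n, ha]
  let e : semiDual N (Algebra.linearMap k F ∘ₗ Coalgebra.counit (A := A)) →ₗ[F]
      ((N ⧸ augSpan k A N) →ₗ[k] F) :=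
    { toFun := fun f => (augSpan k A N).liftQ f.1 (hle f.1 f.2)
      map_add' := fun f f' => by ext; simp
      map_smul' := fun c f => by ext; simp }
  rw [← Module.finrank_linearMap_self k F (N ⧸ augSpan k A N)]
  refine LinearMap.finrank_le_finrank_of_injective (f := e) fun f f' h => ?_
  refine Subtype.ext (LinearMap.ext fun n => ?_)
  exact LinearMap.congr_fun h ((augSpan k A N).mkQ n)

variable {O : Type} [CommRing O] [HopfAlgebra k O]

variable (A) in
/-- The map `n ↦ n₁ ⊗ [n₀]` from a Hopf module `N` to `O ⊗ N/A⁺N`. -/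
noncomputable def toCoinv (ρ : N →ₗ[k] N ⊗[k] O) : N →ₗ[k] O ⊗[k] (N ⧸ augSpan k A N) :=
  (TensorProduct.comm k _ O).toLinearMap ∘ₗ LinearMap.rTensor O (augSpan k A N).mkQ ∘ₗ ρ

theorem toCoinv_smul {i : A →ₗ[k] O} {ρ : N →ₗ[k] N ⊗[k] O} (hρ : IsHopfModule i ρ)
    (a : A) (n : N) : toCoinv A ρ (a • n) = i a • toCoinv A ρ n := by
  have h : ∀ (y : A ⊗[k] A) (z : N ⊗[k] O),
      TensorProduct.comm k _ O (LinearMap.rTensor O (augSpan k A N).mkQ (tensorAct i y z)) =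
        i (TensorProduct.lid k A (LinearMap.rTensor A Coalgebra.counit y)) •
          TensorProduct.comm k _ O (LinearMap.rTensor O (augSpan k A N).mkQ z) := by
    intro y z
    induction y using TensorProduct.induction_on with
    | zero => simp
    | add x y hx hy => simp only [map_add, LinearMap.add_apply, hx, hy, add_smul]
    | tmul a b =>
      induction z using TensorProduct.induction_on with
      | zero => simp
      | add x y hx hy => simp only [map_add, hx, hy, smul_add]
      | tmul n x =>
        rw [tensorAct_tmul, LinearMap.rTensor_tmul, mkQ_augSpan_smul]
        simp only [TensorProduct.comm_tmul, LinearMap.rTensor_tmul, TensorProduct.lid_tmul,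
          map_smul, smul_assoc, TensorProduct.smul_tmul', smul_eq_mul, TensorProduct.tmul_smul]
  simp only [toCoinv, LinearMap.comp_apply, LinearEquiv.coe_coe]
  rw [hρ.smul, h, Coalgebra.rTensor_counit_comul]
  simp

omit [IsScalarTower k A N] in
theorem span_range_toCoinv {ρ : N →ₗ[k] N ⊗[k] O} (hρ : IsComod k O ρ) :
    Submodule.span O (Set.range (toCoinv A ρ)) = ⊤ := by
  have h : ∀ z : N ⊗[k] O, TensorProduct.comm k _ O (LinearMap.rTensor O (augSpan k A N).mkQ
      (twist ρ (AlgHom.id k O).toLinearMap z)) ∈ Submodule.span O (Set.range (toCoinv A ρ)) := by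
    intro z
    induction z using TensorProduct.induction_on with
    | zero => simp
    | add x y hx hy => simp only [map_add]; exact add_mem hx hy
    | tmul n x =>
      have h1 : TensorProduct.comm k _ O (LinearMap.rTensor O (augSpan k A N).mkQ
          (twist ρ (AlgHom.id k O).toLinearMap (n ⊗ₜ x))) = x • toCoinv A ρ n := by
        rw [twist_tmul, toCoinv, LinearMap.comp_apply, LinearMap.comp_apply]
        induction ρ n using TensorProduct.induction_on with
        | zero => simp
        | add x y hx hy => simp only [map_add, smul_add, hx, hy]
        | tmul u v => simp [TensorProduct.smul_tmul', mul_comm]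
      rw [h1]
      exact Submodule.smul_mem _ _ (Submodule.subset_span ⟨n, rfl⟩)
  rw [eq_top_iff]
  rintro y -
  induction y using TensorProduct.induction_on with
  | zero => simp
  | add x y hx hy => exact add_mem hx hy
  | tmul x v =>
    obtain ⟨n, rfl⟩ := (augSpan k A N).mkQ_surjective v
    obtain ⟨z, hz⟩ := twist_surjective hρ (AlgHom.id k O) (n ⊗ₜ x)
    have := h z
    rw [hz] at this
    simpa using this

theorem finrank_semiDual_le_finrank_quotient [Module.Finite A N] {i : A →ₐc[k] O}
    {ρ : N →ₗ[k] N ⊗[k] O} (hρ : IsHopfModule (i : A →ₗ[k] O) ρ) {F : Type} [Field F]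
    [Algebra k F] (g : A →ₗ[k] F) (β β' : O →ₐ[k] F)
    (h : convolve (coactOf (i : A →ₗ[k] O)) β.toLinearMap g =
      convolve (coactOf (i : A →ₗ[k] O)) β'.toLinearMap
          (Algebra.linearMap k F ∘ₗ Coalgebra.counit)) :
    Module.finrank F (semiDual N g) ≤ Module.finrank k (N ⧸ augSpan k A N) := by
  refine (finrank_semiDual_le hρ g β).trans ?_
  rw [h]
  refine (finrank_semiDual_le hρ _ (β'.comp (HopfAlgebra.antipodeAlgHom k O))).trans ?_
  rw [convolve_antipode_convolve (isComod_coactOf i)]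
  exact finrank_semiDual_counit_le F

end Coinvariants

theorem pow_mul_eq_zero_of_smul_mem_span {R E : Type} [CommRing R] [AddCommGroup E] [Module R E]
    {r : ℕ} (b : Module.Basis (Fin r) R E) (j : Fin r → E) (s : R)
    (h : ∀ m, s • b m ∈ Submodule.span R (Set.range j)) (a : Fin r → R)
    (ha : ∑ l, a l • j l = 0) (l : Fin r) : s ^ r * a l = 0 := by
  simp only [Submodule.mem_span_range_iff_exists_fun] at h
  choose c hc using h
  let C : Matrix (Fin r) (Fin r) R := Matrix.of c
  let B : Matrix (Fin r) (Fin r) R := Matrix.of fun l m => b.repr (j l) m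
  have h1 : C * B = s • (1 : Matrix (Fin r) (Fin r) R) := by
    ext m m'
    have := congrArg (fun e => b.repr e m') (hc m)
    simpa [C, B, Matrix.mul_apply, Matrix.one_apply, Finsupp.single_apply] using this
  have h2 : Matrix.vecMul a B = 0 := by
    ext m
    have := congrArg (fun e => b.repr e m) ha
    simpa [B, Matrix.vecMul, dotProduct] using this
  have h3 : C.det * B.det = s ^ r := by
    rw [← Matrix.det_mul, h1]
    simp
  have h4 : B.det • a = 0 := by
    have := congrArg (fun e => Matrix.vecMul e B.adjugate) h2
    simpa [Matrix.vecMul_vecMul, Matrix.mul_adjugate, Matrix.vecMul_smul] using this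
  rw [← h3, mul_assoc]
  have := congrFun h4 l
  simp only [Pi.smul_apply, smul_eq_mul, Pi.zero_apply] at this
  rw [this, mul_zero]

theorem exists_fin_forall_dual_eq_zero {F E N : Type} [Field F] [AddCommGroup E] [Module F E]
    [Module.Finite F E] [Nonempty N] (ev : N → Module.Dual F E) {r : ℕ}
    (hr : Module.finrank F E ≤ r) :
    ∃ n : Fin r → N, ∀ f : E, (∀ l, ev (n l) f = 0) → ∀ m, ev m f = 0 := by
  obtain ⟨φ, hφ, hspan, -⟩ := Submodule.exists_fun_fin_finrank_span_eq F (Set.range ev)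
  choose m hm using hφ
  have hd : Module.finrank F (Submodule.span F (Set.range ev)) ≤ r :=
    (Submodule.finrank_le _).trans (by rwa [Subspace.dual_finrank_eq])
  refine ⟨fun l => if h : l.1 < Module.finrank F (Submodule.span F (Set.range ev)) then
    m ⟨l.1, h⟩ else Classical.arbitrary N, fun f h n => ?_⟩
  have h1 : ∀ ψ ∈ Submodule.span F (Set.range φ), ψ f = 0 := by
    intro ψ hψ
    induction hψ using Submodule.span_induction with
    | mem x hx =>
      obtain ⟨l, rfl⟩ := hx
      have := h ⟨l.1, l.2.trans_le hd⟩
      beta_reduce at this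
      rw [dif_pos l.2] at this
      rw [← hm l]
      exact this
    | zero => simp
    | add x y _ _ hx hy => simp [hx, hy]
    | smul a x _ hx => simp [hx]
  rw [hspan] at h1
  exact h1 (ev n) (Submodule.subset_span ⟨n, rfl⟩)

theorem exists_fin_forall_eq_zero {k F N : Type} [Field k] [Field F] [Algebra k F]
    [AddCommGroup N] [Module k N] (E : Submodule F (N →ₗ[k] F)) [Module.Finite F E] {r : ℕ}
    (hr : Module.finrank F E ≤ r) :
    ∃ n : Fin r → N, ∀ f ∈ E, (∀ l, f (n l) = 0) → f = 0 := by
  obtain ⟨n, hn⟩ := exists_fin_forall_dual_eq_zero (F := F) (E := E) (N := N) (fun n =>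
    { toFun := fun f => f.1 n
      map_add' := fun _ _ => rfl
      map_smul' := fun _ _ => rfl }) hr
  exact ⟨n, fun f hf h => LinearMap.ext fun m => hn ⟨f, hf⟩ h m⟩

section

variable {k : Type} [Field k] {A : Type} [CommRing A] [Algebra k A]
variable {N : Type} [AddCommGroup N] [Module k N] [Module A N] [IsScalarTower k A N]

theorem exists_notMem_forall_smul_mem [Module.Finite A N] (P : Ideal A) [P.IsPrime] {F : Type}
    [Field F] [Algebra k F] (v : P.ResidueField →ₐ[k] F) (N₀ : Submodule A N)
    (h : ∀ f : N →ₗ[k] F, (∀ (a : A) (n : N), f (a • n) = v (algebraMap A P.ResidueField a) * f n) →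
      (∀ n ∈ N₀, f n = 0) → f = 0) :
    ∃ s ∉ P, ∀ n : N, s • n ∈ N₀ := by
  by_contra! hcon
  have hsupp : (⟨P, inferInstance⟩ : PrimeSpectrum A) ∈ Module.support A (N ⧸ N₀) := by
    rw [Module.support_eq_zeroLocus]
    intro s hs
    by_contra hsP
    obtain ⟨n, hn⟩ := hcon s hsP
    refine hn ?_
    rw [← Submodule.Quotient.mk_eq_zero, Submodule.Quotient.mk_smul]
    exact Module.mem_annihilator.1 hs _
  rw [Module.mem_support_iff_nontrivial_residueField_tensorProduct] at hsupp
  change Nontrivial (P.ResidueField ⊗[A] (N ⧸ N₀)) at hsupp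
  obtain ⟨x, hx⟩ := exists_ne (0 : P.ResidueField ⊗[A] (N ⧸ N₀))
  refine hx ((Module.forall_dual_apply_eq_zero_iff P.ResidueField x).1 fun φ => ?_)
  have hsmul : ∀ (a : A) (n : N), φ (1 ⊗ₜ N₀.mkQ (a • n)) =
      algebraMap A P.ResidueField a * φ (1 ⊗ₜ N₀.mkQ n) := by
    intro a n
    rw [map_smul, TensorProduct.tmul_smul, ← algebraMap_smul P.ResidueField a, map_smul,
      smul_eq_mul]
  let f : N →ₗ[k] F :=
    { toFun := fun n => v (φ (1 ⊗ₜ N₀.mkQ n))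
      map_add' := fun n n' => by simp [TensorProduct.tmul_add]
      map_smul' := fun c n => by
        rw [← algebraMap_smul A c n, hsmul, map_mul, ← IsScalarTower.algebraMap_apply,
          AlgHom.commutes, Algebra.smul_def]
        rfl }
  have hfv : ∀ n, f n = v (φ (1 ⊗ₜ N₀.mkQ n)) := fun _ => rfl
  have hf : f = 0 := by
    refine h f (fun a n => ?_) fun n hn => ?_
    · rw [hfv, hfv, hsmul, map_mul]
    · have : N₀.mkQ n = 0 := by simpa using hn
      rw [hfv, this, TensorProduct.tmul_zero, map_zero, map_zero]
  have hφ : ∀ y, φ y = 0 := by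
    intro y
    induction y using TensorProduct.induction_on with
    | zero => simp
    | add x y hx hy => rw [map_add, hx, hy, add_zero]
    | tmul c y =>
      obtain ⟨n, rfl⟩ := N₀.mkQ_surjective y
      have h1 : v (φ (1 ⊗ₜ N₀.mkQ n)) = 0 := by rw [← hfv, hf, LinearMap.zero_apply]
      have h2 : φ (1 ⊗ₜ N₀.mkQ n) = 0 := v.toRingHom.injective (h1.trans (map_zero _).symm)
      rw [← mul_one c, ← smul_eq_mul, ← TensorProduct.smul_tmul', map_smul, h2, smul_zero]
  exact hφ x

end

section

variable {k : Type} [Field k] {O : Type} [CommRing O] [HopfAlgebra k O]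
variable {A : Type} [CommRing A] [HopfAlgebra k A]
variable {N : Type} [AddCommGroup N] [Module k N] [Module A N] [IsScalarTower k A N]

theorem toCoinv_mem_span {i : A →ₗ[k] O} {ρ : N →ₗ[k] N ⊗[k] O} (hρ : IsHopfModule i ρ) {r : ℕ}
    (n : Fin r → N) {m : N} (hm : m ∈ Submodule.span A (Set.range n)) :
    toCoinv A ρ m ∈ Submodule.span O (Set.range fun l => toCoinv A ρ (n l)) := by
  induction hm using Submodule.span_induction with
  | mem x hx =>
    obtain ⟨l, rfl⟩ := hx
    exact Submodule.subset_span ⟨l, rfl⟩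
  | zero => simp
  | add x y _ _ hx hy => rw [map_add]; exact add_mem hx hy
  | smul a x _ hx => rw [toCoinv_smul hρ]; exact Submodule.smul_mem _ _ hx

theorem toCoinv_injective_of_finite [Module.Finite A N] {i : A →ₐc[k] O}
    (hi : Function.Injective i) {ρ : N →ₗ[k] N ⊗[k] O} (hρ : IsHopfModule (i : A →ₗ[k] O) ρ) :
    Function.Injective (toCoinv A ρ) := by
  refine (injective_iff_map_eq_zero _).2 fun n₀ hn₀ => by_contra fun hne => ?_
  have hann : Submodule.annihilator (Submodule.span A {n₀}) ≠ ⊤ := by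
    intro h
    refine hne ?_
    have := (Ideal.eq_top_iff_one _).1 h
    rw [Submodule.mem_annihilator_span_singleton, one_smul] at this
    exact this
  obtain ⟨P, hP, hPle⟩ := Ideal.exists_le_maximal _ hann
  obtain ⟨F, _, _, v, β, β', hconv⟩ :=
    exists_field_convolve_eq (IsScalarTower.toAlgHom k A P.ResidueField) i hi
  set g := v.toLinearMap ∘ₗ (IsScalarTower.toAlgHom k A P.ResidueField).toLinearMap
  have := finite_quotient_augSpan (k := k) (A := A) (N := N)
  have := finite_semiDual (N := N) g
  obtain ⟨n, hn⟩ := exists_fin_forall_eq_zero (semiDual N g)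
    (finrank_semiDual_le_finrank_quotient hρ g β β' hconv)
  obtain ⟨s, hsP, hs⟩ := exists_notMem_forall_smul_mem P v (Submodule.span A (Set.range n))
    fun f hf h => hn f hf fun l => h _ (Submodule.subset_span ⟨l, rfl⟩)
  have hspan : ∀ e, i s • e ∈ Submodule.span O (Set.range fun l => toCoinv A ρ (n l)) := by
    intro e
    have he : e ∈ Submodule.span O (Set.range (toCoinv A ρ)) := by
      rw [span_range_toCoinv hρ.comod]
      trivial
    induction he using Submodule.span_induction with
    | mem x hx =>
      obtain ⟨m, rfl⟩ := hx
      rw [← show toCoinv A ρ (s • m) = i s • toCoinv A ρ m from toCoinv_smul hρ s m]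
      exact toCoinv_mem_span hρ n (hs m)
    | zero => simp
    | add x y _ _ hx hy => rw [smul_add]; exact add_mem hx hy
    | smul a x _ hx => rw [smul_comm]; exact Submodule.smul_mem _ _ hx
  obtain ⟨a, ha⟩ := (Submodule.mem_span_range_iff_exists_fun A).1 (hs n₀)
  have hzero : ∑ l, i (a l) • toCoinv A ρ (n l) = 0 := by
    have h1 : ∀ l, i (a l) • toCoinv A ρ (n l) = toCoinv A ρ (a l • n l) :=
      fun l => (toCoinv_smul hρ (a l) (n l)).symm
    have h2 : toCoinv A ρ (s • n₀) = i s • toCoinv A ρ n₀ := toCoinv_smul hρ s n₀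
    simp only [h1]
    rw [← map_sum, ha, h2, hn₀, smul_zero]
  have hpow := pow_mul_eq_zero_of_smul_mem_span
    (Algebra.TensorProduct.basis O (Module.finBasis k (N ⧸ augSpan k A N)))
    (fun l => toCoinv A ρ (n l)) (i s) (fun m => hspan _) (fun l => i (a l)) hzero
  have hpow' : ∀ l, s ^ Module.finrank k (N ⧸ augSpan k A N) * a l = 0 := fun l =>
    hi (by rw [map_mul, map_pow, hpow l, map_zero])
  have hkill : s ^ Module.finrank k (N ⧸ augSpan k A N) * s ∈
      Submodule.annihilator (Submodule.span A {n₀}) := by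
    rw [Submodule.mem_annihilator_span_singleton, mul_smul, ← ha, Finset.smul_sum]
    exact Finset.sum_eq_zero fun l _ => by rw [smul_smul, hpow' l, zero_smul]
  rcases hP.isPrime.mem_or_mem (hPle hkill) with h | h
  · exact hsP (hP.isPrime.mem_of_pow_mem _ h)
  · exact hsP h

end

section Comodule

variable {k : Type} [Field k] {O : Type} [AddCommGroup O] [Module k O]
variable {N : Type} [AddCommGroup N] [Module k N]

/-- The slice `φ ↦ (id ⊗ φ) z` of an element `z` of `N ⊗ O`. -/
noncomputable def slice (z : N ⊗[k] O) : Module.Dual k O →ₗ[k] N :=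
  (TensorProduct.rid k N).toLinearMap ∘ₗ LinearMap.applyₗ z ∘ₗ LinearMap.lTensorHom N

theorem slice_apply (z : N ⊗[k] O) (φ : Module.Dual k O) :
    slice z φ = TensorProduct.rid k N (LinearMap.lTensor N φ z) :=
  rfl

theorem mem_range_rTensor_slice (z : N ⊗[k] O) :
    z ∈ LinearMap.range (LinearMap.rTensor O (LinearMap.range (slice z)).subtype) := by
  let b := Module.Basis.ofVectorSpace k O
  obtain ⟨c, hc⟩ := TensorProduct.eq_repr_basis_right b z
  have h : ∀ j, slice z (b.coord j) = c j := by
    intro j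
    rw [slice_apply, ← hc, Finsupp.sum, map_sum, map_sum, Finset.sum_eq_single j]
    · simp
    · intro l _ hl
      simp [hl]
    · intro hj
      simp [Finsupp.notMem_support_iff.1 hj]
  conv in (occs := 1) z => rw [← hc]
  refine Submodule.sum_mem _ fun j _ => ⟨⟨c j, ⟨b.coord j, h j⟩⟩ ⊗ₜ b j, ?_⟩
  simp

theorem fg_range_slice (z : N ⊗[k] O) : (LinearMap.range (slice z)).FG := by
  induction z using TensorProduct.induction_on with
  | zero =>
    have : LinearMap.range (slice (0 : N ⊗[k] O)) = ⊥ := by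
      rw [LinearMap.range_eq_bot]
      ext φ
      simp [slice_apply]
    rw [this]
    exact Submodule.fg_bot
  | add x y hx hy =>
    refine Submodule.FG.of_le (hx.sup hy) ?_
    rintro _ ⟨φ, rfl⟩
    rw [slice_apply, map_add, map_add]
    exact Submodule.add_mem_sup ⟨φ, rfl⟩ ⟨φ, rfl⟩
  | tmul x y =>
    refine Submodule.FG.of_le (Submodule.fg_span_singleton x) ?_
    rintro _ ⟨φ, rfl⟩
    rw [slice_apply]
    simpa using Submodule.smul_mem _ _ (Submodule.mem_span_singleton_self x)

variable [Coalgebra k O]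

theorem mem_range_slice {ρ : N →ₗ[k] N ⊗[k] O} (hρ : IsComod k O ρ) (x : N) :
    x ∈ LinearMap.range (slice (ρ x)) :=
  ⟨Coalgebra.counit, hρ.counit x⟩

theorem coact_mem_range_slice {ρ : N →ₗ[k] N ⊗[k] O} (hρ : IsComod k O ρ) (x : N) {y : N}
    (hy : y ∈ LinearMap.range (slice (ρ x))) :
    ρ y ∈ LinearMap.range (LinearMap.rTensor O (LinearMap.range (slice (ρ x))).subtype) := by
  obtain ⟨φ, rfl⟩ := hy
  let ψ : O →ₗ[k] O :=
    (TensorProduct.rid k O).toLinearMap ∘ₗ LinearMap.lTensor O φ ∘ₗ Coalgebra.comul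
  have h1 : ∀ z : N ⊗[k] O, ρ (slice z φ) = TensorProduct.rid k _
      (LinearMap.lTensor _ φ ((TensorProduct.map ρ (LinearMap.id : O →ₗ[k] O)) z)) := by
    intro z
    rw [slice_apply]
    induction z using TensorProduct.induction_on with
    | zero => simp
    | add x y hx hy => simp only [map_add, hx, hy]
    | tmul x y => simp
  have h2 : ∀ z : N ⊗[k] (O ⊗[k] O), TensorProduct.rid k _
      (LinearMap.lTensor _ φ ((TensorProduct.assoc k N O O).symm z)) =
      LinearMap.lTensor N ((TensorProduct.rid k O).toLinearMap ∘ₗ LinearMap.lTensor O φ) z := by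
    intro z
    induction z using TensorProduct.induction_on with
    | zero => simp
    | add x y hx hy => simp only [map_add, hx, hy]
    | tmul x y =>
      induction y using TensorProduct.induction_on with
      | zero => simp
      | add y z hx hy => simp only [map_add, TensorProduct.tmul_add, hx, hy]
      | tmul y z => simp
  have h3 : ρ (slice (ρ x) φ) = LinearMap.lTensor N ψ (ρ x) := by
    rw [h1, ← (TensorProduct.assoc k N O O).symm_apply_apply (TensorProduct.map ρ LinearMap.id _),
      hρ.coassoc, h2]
    exact (LinearMap.lTensor_comp_apply N _ _ _).symm
  obtain ⟨w, hw⟩ := mem_range_rTensor_slice (ρ x)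
  rw [h3]
  refine ⟨LinearMap.lTensor _ ψ w, ?_⟩
  conv_rhs => rw [← hw]
  rw [← LinearMap.comp_apply, ← LinearMap.comp_apply, LinearMap.lTensor_comp_rTensor,
    LinearMap.rTensor_comp_lTensor]

end Comodule

section HopfModule

variable {k : Type} [Field k] {O : Type} [CommRing O] [HopfAlgebra k O]
variable {A : Type} [CommRing A] [HopfAlgebra k A]
variable {N : Type} [AddCommGroup N] [Module k N] [Module A N] [IsScalarTower k A N]
variable {Q : Type} [AddCommGroup Q] [Module k Q] [Module A Q] [IsScalarTower k A Q]

theorem rTensor_tensorAct (i : A →ₗ[k] O) (f : N →ₗ[A] Q) (y : A ⊗[k] A) (z : N ⊗[k] O) :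
    LinearMap.rTensor O (f.restrictScalars k) (tensorAct i y z) =
      tensorAct i y (LinearMap.rTensor O (f.restrictScalars k) z) := by
  induction y using TensorProduct.induction_on with
  | zero => simp
  | add x y hx hy => simp only [map_add, LinearMap.add_apply, hx, hy]
  | tmul a b =>
    induction z using TensorProduct.induction_on with
    | zero => simp
    | add x y hx hy => simp only [map_add, hx, hy]
    | tmul n x => simp

omit [Module A N] [IsScalarTower k A N] [Module A Q] [IsScalarTower k A Q] in
theorem assoc_map_rTensor {ρ : N →ₗ[k] N ⊗[k] O} {ρ' : Q →ₗ[k] Q ⊗[k] O} (f : N →ₗ[k] Q)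
    (h : ∀ n, LinearMap.rTensor O f (ρ n) = ρ' (f n)) (n : N) :
    TensorProduct.assoc k Q O O (TensorProduct.map ρ' LinearMap.id (ρ' (f n))) =
      LinearMap.rTensor (O ⊗[k] O) f
        (TensorProduct.assoc k N O O (TensorProduct.map ρ LinearMap.id (ρ n))) := by
  rw [← h]
  induction ρ n using TensorProduct.induction_on with
  | zero => simp
  | add x y hx hy => simp only [map_add, hx, hy]
  | tmul n x =>
    simp only [LinearMap.rTensor_tmul, TensorProduct.map_tmul, ← h, LinearMap.id_apply]
    induction ρ n using TensorProduct.induction_on with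
    | zero => simp
    | add x y hx hy => simp only [map_add, TensorProduct.add_tmul, hx, hy]
    | tmul n x => simp

omit [Module A N] [IsScalarTower k A N] [Module A Q] [IsScalarTower k A Q] in
theorem map_comul_rTensor {ρ : N →ₗ[k] N ⊗[k] O} {ρ' : Q →ₗ[k] Q ⊗[k] O} (f : N →ₗ[k] Q)
    (h : ∀ n, LinearMap.rTensor O f (ρ n) = ρ' (f n)) (n : N) :
    TensorProduct.map LinearMap.id Coalgebra.comul (ρ' (f n)) =
      LinearMap.rTensor (O ⊗[k] O) f
        (TensorProduct.map LinearMap.id (Coalgebra.comul (R := k)) (ρ n)) := by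
  rw [← h]
  induction ρ n using TensorProduct.induction_on with
  | zero => simp
  | add x y hx hy => simp only [map_add, hx, hy]
  | tmul n x => simp

omit [Module A N] [IsScalarTower k A N] [Module A Q] [IsScalarTower k A Q] in
theorem rid_counit_rTensor {ρ : N →ₗ[k] N ⊗[k] O} {ρ' : Q →ₗ[k] Q ⊗[k] O} (f : N →ₗ[k] Q)
    (h : ∀ n, LinearMap.rTensor O f (ρ n) = ρ' (f n)) (n : N) :
    TensorProduct.rid k Q (TensorProduct.map LinearMap.id Coalgebra.counit (ρ' (f n))) =
      f (TensorProduct.rid k N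
        (TensorProduct.map LinearMap.id (Coalgebra.counit (R := k)) (ρ n))) := by
  rw [← h]
  induction ρ n using TensorProduct.induction_on with
  | zero => simp
  | add x y hx hy => simp only [map_add, hx, hy]
  | tmul n x => simp

theorem IsHopfModule.of_injective {i : A →ₗ[k] O} {ρ : N →ₗ[k] N ⊗[k] O}
    {ρ' : Q →ₗ[k] Q ⊗[k] O} (hρ' : IsHopfModule i ρ') (f : N →ₗ[A] Q)
    (hf : Function.Injective f)
    (h : ∀ n, LinearMap.rTensor O (f.restrictScalars k) (ρ n) = ρ' (f n)) :
    IsHopfModule i ρ where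
  comod :=
    { coassoc := fun n => by
        refine Module.Flat.rTensor_preserves_injective_linearMap (M := O ⊗[k] O)
          (f.restrictScalars k) hf ?_
        rw [← assoc_map_rTensor (f.restrictScalars k) h,
          ← map_comul_rTensor (f.restrictScalars k) h]
        exact hρ'.comod.coassoc _
      counit := fun n => by
        refine hf ((rid_counit_rTensor (f.restrictScalars k) h n).symm.trans ?_)
        exact hρ'.comod.counit _ }
  smul a n := by
    refine Module.Flat.rTensor_preserves_injective_linearMap (M := O) (f.restrictScalars k) hf ?_
    rw [rTensor_tensorAct, h, h, map_smul, hρ'.smul]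

theorem IsHopfModule.of_surjective {i : A →ₗ[k] O} {ρ : N →ₗ[k] N ⊗[k] O}
    {ρ' : Q →ₗ[k] Q ⊗[k] O} (hρ : IsHopfModule i ρ) (f : N →ₗ[A] Q)
    (hf : Function.Surjective f)
    (h : ∀ n, LinearMap.rTensor O (f.restrictScalars k) (ρ n) = ρ' (f n)) :
    IsHopfModule i ρ' where
  comod :=
    { coassoc := fun x => by
        obtain ⟨n, rfl⟩ := hf x
        refine (assoc_map_rTensor (f.restrictScalars k) h n).trans ?_
        rw [hρ.comod.coassoc]
        exact (map_comul_rTensor (f.restrictScalars k) h n).symm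
      counit := fun x => by
        obtain ⟨n, rfl⟩ := hf x
        refine (rid_counit_rTensor (f.restrictScalars k) h n).trans ?_
        rw [hρ.comod.counit]
        rfl }
  smul a x := by
    obtain ⟨n, rfl⟩ := hf x
    rw [← map_smul, ← h, ← h, hρ.smul, rTensor_tensorAct]

/-- A submodule of a Hopf module is stable if the coaction restricts to it. -/
def IsStable (ρ : Q →ₗ[k] Q ⊗[k] O) (N : Submodule A Q) : Prop :=
  ∀ n ∈ N, ρ n ∈ LinearMap.range (LinearMap.rTensor O (N.subtype.restrictScalars k))

omit [IsScalarTower k A Q] in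
theorem range_rTensor_mono {X : Type} [AddCommGroup X] [Module k X] {Y : Type} [AddCommGroup Y]
    [Module k Y] (f : X →ₗ[k] Q) (g : Y →ₗ[k] Q)
    (h : LinearMap.range f ≤ LinearMap.range g) :
    LinearMap.range (LinearMap.rTensor O f) ≤ LinearMap.range (LinearMap.rTensor O g) := by
  rintro _ ⟨z, rfl⟩
  induction z using TensorProduct.induction_on with
  | zero => simp
  | add x y hx hy => rw [map_add]; exact add_mem hx hy
  | tmul x o =>
    obtain ⟨y, hy⟩ := h ⟨x, rfl⟩
    exact ⟨y ⊗ₜ o, by simp [hy]⟩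

theorem IsStable.sup {ρ : Q →ₗ[k] Q ⊗[k] O} {N N' : Submodule A Q} (h : IsStable ρ N)
    (h' : IsStable ρ N') : IsStable ρ (N ⊔ N') := by
  intro n hn
  obtain ⟨a, ha, b, hb, rfl⟩ := Submodule.mem_sup.1 hn
  rw [map_add]
  refine add_mem (range_rTensor_mono _ _ ?_ (h a ha)) (range_rTensor_mono _ _ ?_ (h' b hb))
  · rintro _ ⟨x, rfl⟩
    exact ⟨⟨x, Submodule.mem_sup_left x.2⟩, rfl⟩
  · rintro _ ⟨x, rfl⟩
    exact ⟨⟨x, Submodule.mem_sup_right x.2⟩, rfl⟩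

theorem exists_fg_isStable {i : A →ₗ[k] O} {ρ : Q →ₗ[k] Q ⊗[k] O} (hρ : IsHopfModule i ρ)
    (x : Q) : ∃ N : Submodule A Q, N.FG ∧ IsStable ρ N ∧ x ∈ N := by
  obtain ⟨s, hs⟩ := fg_range_slice (ρ x)
  have hle : ∀ y ∈ LinearMap.range (slice (ρ x)), y ∈ Submodule.span A (s : Set Q) := by
    intro y hy
    rw [← hs] at hy
    exact Submodule.span_le_restrictScalars k A _ hy
  refine ⟨Submodule.span A s, ⟨s, rfl⟩, fun n hn => ?_, hle _ (mem_range_slice hρ.comod x)⟩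
  induction hn using Submodule.span_induction with
  | mem y hy =>
    have hy' : y ∈ LinearMap.range (slice (ρ x)) := hs ▸ Submodule.subset_span hy
    refine range_rTensor_mono _ _ ?_ (coact_mem_range_slice hρ.comod x hy')
    rintro _ ⟨w, rfl⟩
    exact ⟨⟨w, hle _ w.2⟩, rfl⟩
  | zero => simp
  | add x y _ _ hx hy => rw [map_add]; exact add_mem hx hy
  | smul a y _ hy =>
    obtain ⟨z, hz⟩ := hy
    rw [hρ.smul, ← hz]
    exact ⟨_, rTensor_tensorAct i _ _ z⟩

/-- The restriction of the coaction to a stable submodule. -/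
theorem IsStable.exists_coact {ρ : Q →ₗ[k] Q ⊗[k] O} {N : Submodule A Q} (h : IsStable ρ N) :
    ∃ ρN : N →ₗ[k] N ⊗[k] O,
      ∀ n, LinearMap.rTensor O (N.subtype.restrictScalars k) (ρN n) = ρ n := by
  have hinj : Function.Injective (LinearMap.rTensor O (N.subtype.restrictScalars k)) :=
    Module.Flat.rTensor_preserves_injective_linearMap _ N.subtype_injective
  refine ⟨(LinearEquiv.ofInjective _ hinj).symm.toLinearMap ∘ₗ
    LinearMap.codRestrict _ (ρ ∘ₗ N.subtype.restrictScalars k) fun n => h n n.2, fun n => ?_⟩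
  exact congrArg Subtype.val ((LinearEquiv.ofInjective _ hinj).apply_symm_apply _)

variable (k O) in
/-- The span of the `a n ⊗ x` with `ε(a) = 0`, `n ∈ N` and `x ∈ O`. -/
def augTensor (N : Submodule A Q) : Submodule k (Q ⊗[k] O) :=
  Submodule.span k {y | ∃ (a : A) (n : Q) (x : O), Coalgebra.counit (R := k) a = 0 ∧ n ∈ N ∧
    y = (a • n) ⊗ₜ[k] x}

omit [IsScalarTower k A Q] in
theorem augTensor_mono {N N' : Submodule A Q} (h : N ≤ N') :
    augTensor k O N ≤ augTensor k O N' := by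
  refine Submodule.span_mono ?_
  rintro y ⟨a, n, x, ha, hn, rfl⟩
  exact ⟨a, n, x, ha, h hn, rfl⟩

theorem exists_fg_mem_augTensor {i : A →ₗ[k] O} {ρ : Q →ₗ[k] Q ⊗[k] O}
    (hρ : IsHopfModule i ρ) (z : augSpan k A Q ⊗[k] O) :
    ∃ N : Submodule A Q, N.FG ∧ IsStable ρ N ∧
      LinearMap.rTensor O (augSpan k A Q).subtype z ∈ augTensor k O N := by
  induction z using TensorProduct.induction_on with
  | zero => exact ⟨⊥, Submodule.fg_bot, fun n hn => by simp_all, by simp⟩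
  | add x y hx hy =>
    obtain ⟨N, hN, hs, hx⟩ := hx
    obtain ⟨N', hN', hs', hy⟩ := hy
    refine ⟨N ⊔ N', hN.sup hN', hs.sup hs', ?_⟩
    rw [map_add]
    exact add_mem (augTensor_mono le_sup_left hx) (augTensor_mono le_sup_right hy)
  | tmul x o =>
    obtain ⟨x, hx⟩ := x
    simp only [LinearMap.rTensor_tmul, Submodule.subtype_apply]
    induction hx using Submodule.span_induction with
    | mem x hx =>
      obtain ⟨a, n, ha, rfl⟩ := hx
      obtain ⟨N, hN, hs, hn⟩ := exists_fg_isStable hρ n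
      exact ⟨N, hN, hs, Submodule.subset_span ⟨a, n, o, ha, hn, rfl⟩⟩
    | zero => exact ⟨⊥, Submodule.fg_bot, fun n hn => by simp_all, by simp⟩
    | add x y _ _ hx hy =>
      obtain ⟨N, hN, hs, hx⟩ := hx
      obtain ⟨N', hN', hs', hy⟩ := hy
      refine ⟨N ⊔ N', hN.sup hN', hs.sup hs', ?_⟩
      rw [TensorProduct.add_tmul]
      exact add_mem (augTensor_mono le_sup_left hx) (augTensor_mono le_sup_right hy)
    | smul c x _ hx =>
      obtain ⟨N, hN, hs, hx⟩ := hx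
      refine ⟨N, hN, hs, ?_⟩
      rw [← TensorProduct.smul_tmul']
      exact Submodule.smul_mem _ _ hx

theorem rTensor_mkQ_eq_zero_of_mem_augTensor (N : Submodule A Q) (w : N ⊗[k] O)
    (hw : LinearMap.rTensor O (N.subtype.restrictScalars k) w ∈ augTensor k O N) :
    LinearMap.rTensor O (augSpan k A N).mkQ w = 0 := by
  have hinj : Function.Injective (LinearMap.rTensor O (N.subtype.restrictScalars k)) :=
    Module.Flat.rTensor_preserves_injective_linearMap _ N.subtype_injective
  have hle : augTensor k O N ≤ (LinearMap.ker (LinearMap.rTensor O (augSpan k A N).mkQ)).map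
      (LinearMap.rTensor O (N.subtype.restrictScalars k)) := by
    refine Submodule.span_le.2 ?_
    rintro y ⟨a, n, x, ha, hn, rfl⟩
    refine ⟨(a • (⟨n, hn⟩ : N)) ⊗ₜ x, ?_, by simp⟩
    simp only [SetLike.mem_coe, LinearMap.mem_ker]
    rw [LinearMap.rTensor_tmul, mkQ_augSpan_smul, ha, zero_smul, TensorProduct.zero_tmul]
  obtain ⟨w', hw', h⟩ := hle hw
  rw [← hinj h]
  exact hw'

theorem toCoinv_injective {i : A →ₐc[k] O} (hi : Function.Injective i)
    {ρ : Q →ₗ[k] Q ⊗[k] O} (hρ : IsHopfModule (i : A →ₗ[k] O) ρ) :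
    Function.Injective (toCoinv A ρ) := by
  refine (injective_iff_map_eq_zero _).2 fun x hx => ?_
  have hx' : LinearMap.rTensor O (augSpan k A Q).mkQ (ρ x) = 0 :=
    (TensorProduct.comm k _ O).injective (hx.trans (map_zero _).symm)
  have hexact : Function.Exact (LinearMap.rTensor O (augSpan k A Q).subtype)
      (LinearMap.rTensor O (augSpan k A Q).mkQ) :=
    rTensor_exact O (LinearMap.exact_subtype_mkQ _) (Submodule.mkQ_surjective _)
  obtain ⟨z, hz⟩ := (hexact _).1 hx'
  obtain ⟨N₁, hN₁, hs₁, hz₁⟩ := exists_fg_mem_augTensor hρ z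
  obtain ⟨N₂, hN₂, hs₂, hx₂⟩ := exists_fg_isStable hρ x
  have hxN : x ∈ N₁ ⊔ N₂ := Submodule.mem_sup_right hx₂
  obtain ⟨ρN, hρN⟩ := (hs₁.sup hs₂).exists_coact
  have : Module.Finite A ↥(N₁ ⊔ N₂) := Module.Finite.iff_fg.2 (hN₁.sup hN₂)
  have hzero : toCoinv A ρN ⟨x, hxN⟩ = 0 := by
    rw [toCoinv, LinearMap.comp_apply, LinearMap.comp_apply,
      rTensor_mkQ_eq_zero_of_mem_augTensor, map_zero]
    rw [hρN, ← hz]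
    exact augTensor_mono le_sup_left hz₁
  have hN := hρ.of_injective (N₁ ⊔ N₂).subtype (Submodule.subtype_injective _) hρN
  exact congrArg Subtype.val
    ((injective_iff_map_eq_zero _).1 (toCoinv_injective_of_finite hi hN) _ hzero)

end HopfModule

section Restrict

variable {k : Type} [Field k] {X Y : Type} [AddCommGroup X] [Module k X] [AddCommGroup Y]
  [Module k Y]

theorem map_map_assoc_map {δ : X →ₗ[k] X ⊗[k] X} {δ' : Y →ₗ[k] Y ⊗[k] Y} {f : X →ₗ[k] Y}
    (h : ∀ x, TensorProduct.map f f (δ x) = δ' (f x)) (z : X ⊗[k] X) :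
    TensorProduct.map f (TensorProduct.map f f)
      (TensorProduct.assoc k X X X (TensorProduct.map δ LinearMap.id z)) =
    TensorProduct.assoc k Y Y Y (LinearMap.rTensor Y δ' (TensorProduct.map f f z)) := by
  induction z using TensorProduct.induction_on with
  | zero => simp
  | add x y hx hy => simp only [map_add, hx, hy]
  | tmul x y =>
    simp only [TensorProduct.map_tmul, LinearMap.rTensor_tmul, ← h, LinearMap.id_apply]
    induction δ x using TensorProduct.induction_on with
    | zero => simp
    | add x y hx hy => simp only [map_add, TensorProduct.add_tmul, hx, hy]
    | tmul u v => simp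

theorem map_map_map_id {δ : X →ₗ[k] X ⊗[k] X} {δ' : Y →ₗ[k] Y ⊗[k] Y} {f : X →ₗ[k] Y}
    (h : ∀ x, TensorProduct.map f f (δ x) = δ' (f x)) (z : X ⊗[k] X) :
    TensorProduct.map f (TensorProduct.map f f) (TensorProduct.map LinearMap.id δ z) =
    LinearMap.lTensor Y δ' (TensorProduct.map f f z) := by
  induction z using TensorProduct.induction_on with
  | zero => simp
  | add x y hx hy => simp only [map_add, hx, hy]
  | tmul x y => simp [← h]

end Restrict

section HopfSub

variable {k : Type} [Field k] {O : Type} [CommRing O] [HopfAlgebra k O] {A : Subalgebra k O}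

theorem injective_map_val : Function.Injective (Algebra.TensorProduct.map A.val A.val) :=
  TensorProduct.map_injective_of_flat_flat A.val.toLinearMap A.val.toLinearMap
    Subtype.val_injective Subtype.val_injective

theorem injective_map_map_val : Function.Injective
    (TensorProduct.map A.val.toLinearMap (TensorProduct.map A.val.toLinearMap A.val.toLinearMap)) :=
  TensorProduct.map_injective_of_flat_flat _ _ Subtype.val_injective injective_map_val

theorem IsHopfSub.comul_mem_range (hA : IsHopfSub k O A) (a : A) :
    Coalgebra.comul (R := k) (a : O) ∈ (Algebra.TensorProduct.map A.val A.val).range := by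
  have h : Submodule.span k {x : O ⊗[k] O | ∃ b ∈ A, ∃ c ∈ A, x = b ⊗ₜ[k] c} ≤
      (Algebra.TensorProduct.map A.val A.val).range.toSubmodule := by
    refine Submodule.span_le.2 ?_
    rintro x ⟨b, hb, c, hc, rfl⟩
    exact ⟨(⟨b, hb⟩ : A) ⊗ₜ (⟨c, hc⟩ : A), rfl⟩
  exact h (hA.comul_mem a a.2)

/-- The comultiplication of a Hopf subalgebra. -/
noncomputable def IsHopfSub.comulAlgHom (hA : IsHopfSub k O A) : A →ₐ[k] A ⊗[k] A :=
  (AlgEquiv.ofInjective (Algebra.TensorProduct.map A.val A.val)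
    injective_map_val).symm.toAlgHom.comp
    (((Bialgebra.comulAlgHom k O).comp A.val).codRestrict _ hA.comul_mem_range)

theorem IsHopfSub.map_val_comulAlgHom (hA : IsHopfSub k O A) (a : A) :
    TensorProduct.map A.val.toLinearMap A.val.toLinearMap (hA.comulAlgHom a) =
      Coalgebra.comul (R := k) (a : O) :=
  congrArg Subtype.val ((AlgEquiv.ofInjective (Algebra.TensorProduct.map A.val A.val)
    injective_map_val).apply_symm_apply _)

/-- A Hopf subalgebra is a bialgebra. -/
noncomputable abbrev IsHopfSub.bialgebra (hA : IsHopfSub k O A) : Bialgebra k A :=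
  Bialgebra.ofAlgHom hA.comulAlgHom ((Bialgebra.counitAlgHom k O).comp A.val)
    (by
      refine AlgHom.ext fun a => injective_map_map_val ?_
      have h : ∀ x, TensorProduct.map A.val.toLinearMap A.val.toLinearMap
          (hA.comulAlgHom.toLinearMap x) = Coalgebra.comul (R := k) (A.val.toLinearMap x) :=
        hA.map_val_comulAlgHom
      refine (map_map_assoc_map h _).trans (Eq.trans ?_ (map_map_map_id h _).symm)
      refine (congrArg _ (congrArg _ (h a))).trans (Eq.trans ?_ (congrArg _ (h a)).symm)
      exact Coalgebra.coassoc_apply _)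
    (by
      refine AlgHom.ext fun a => ?_
      have h1 : ∀ z : A ⊗[k] A, LinearMap.lTensor k A.val.toLinearMap
          (TensorProduct.map (Coalgebra.counit ∘ₗ A.val.toLinearMap) LinearMap.id z) =
          LinearMap.rTensor O Coalgebra.counit
            (TensorProduct.map A.val.toLinearMap A.val.toLinearMap z) := by
        intro z
        induction z using TensorProduct.induction_on with
        | zero => simp
        | add x y hx hy => simp only [map_add, hx, hy]
        | tmul x y => simp
      refine Module.Flat.lTensor_preserves_injective_linearMap (M := k) A.val.toLinearMap
        Subtype.val_injective ?_
      refine (h1 _).trans ?_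
      refine (congrArg _ (hA.map_val_comulAlgHom a)).trans ?_
      exact Coalgebra.rTensor_counit_comul _)
    (by
      refine AlgHom.ext fun a => ?_
      have h1 : ∀ z : A ⊗[k] A, LinearMap.rTensor k A.val.toLinearMap
          (TensorProduct.map LinearMap.id (Coalgebra.counit ∘ₗ A.val.toLinearMap) z) =
          LinearMap.lTensor O Coalgebra.counit
            (TensorProduct.map A.val.toLinearMap A.val.toLinearMap z) := by
        intro z
        induction z using TensorProduct.induction_on with
        | zero => simp
        | add x y hx hy => simp only [map_add, hx, hy]
        | tmul x y => simp
      refine Module.Flat.rTensor_preserves_injective_linearMap (M := k) A.val.toLinearMap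
        Subtype.val_injective ?_
      refine (h1 _).trans ?_
      refine (congrArg _ (hA.map_val_comulAlgHom a)).trans ?_
      exact Coalgebra.lTensor_counit_comul _)

/-- The antipode of a Hopf subalgebra. -/
noncomputable def IsHopfSub.antipode (hA : IsHopfSub k O A) : A →ₗ[k] A :=
  (HopfAlgebra.antipode k ∘ₗ A.val.toLinearMap).codRestrict A.toSubmodule
    fun a => hA.antipode_mem a a.2

/-- A Hopf subalgebra is a Hopf algebra. -/
noncomputable abbrev IsHopfSub.hopfAlgebra (hA : IsHopfSub k O A) : HopfAlgebra k A where
  __ := hA.bialgebra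
  antipode := hA.antipode
  mul_antipode_rTensor_comul := by
    refine LinearMap.ext fun a => Subtype.ext ?_
    have h1 : ∀ z : A ⊗[k] A,
        ((LinearMap.mul' k A (LinearMap.rTensor A hA.antipode z) : A) : O) =
        LinearMap.mul' k O (LinearMap.rTensor O (HopfAlgebra.antipode k)
          (TensorProduct.map A.val.toLinearMap A.val.toLinearMap z)) := by
      intro z
      induction z using TensorProduct.induction_on with
      | zero => simp
      | add x y hx hy => simp only [map_add, Subalgebra.coe_add, hx, hy]
      | tmul x y =>
        simp only [LinearMap.rTensor_tmul, LinearMap.mul'_apply,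
          TensorProduct.map_tmul, Subalgebra.coe_mul]
        rfl
    refine (h1 _).trans ?_
    refine (congrArg _ (congrArg _ (hA.map_val_comulAlgHom a))).trans ?_
    exact HopfAlgebra.mul_antipode_rTensor_comul_apply _
  mul_antipode_lTensor_comul := by
    refine LinearMap.ext fun a => Subtype.ext ?_
    have h1 : ∀ z : A ⊗[k] A,
        ((LinearMap.mul' k A (LinearMap.lTensor A hA.antipode z) : A) : O) =
        LinearMap.mul' k O (LinearMap.lTensor O (HopfAlgebra.antipode k)
          (TensorProduct.map A.val.toLinearMap A.val.toLinearMap z)) := by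
      intro z
      induction z using TensorProduct.induction_on with
      | zero => simp
      | add x y hx hy => simp only [map_add, Subalgebra.coe_add, hx, hy]
      | tmul x y =>
        simp only [LinearMap.lTensor_tmul, LinearMap.mul'_apply,
          TensorProduct.map_tmul, Subalgebra.coe_mul]
        rfl
    refine (h1 _).trans ?_
    refine (congrArg _ (congrArg _ (hA.map_val_comulAlgHom a))).trans ?_
    exact HopfAlgebra.mul_antipode_lTensor_comul_apply _

/-- The inclusion of a Hopf subalgebra, as a bialgebra map. -/
noncomputable def IsHopfSub.incl (hA : IsHopfSub k O A) :
    letI := hA.hopfAlgebra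
    A →ₐc[k] O :=
  letI := hA.hopfAlgebra
  BialgHom.ofAlgHom A.val (AlgHom.ext fun _ => rfl)
    (AlgHom.ext fun a => hA.map_val_comulAlgHom a)

end HopfSub

section Coinvariants

variable {k : Type} [Field k] {O : Type} [CommRing O] [HopfAlgebra k O]
variable {A : Type} [CommRing A] [HopfAlgebra k A] [Algebra A O] [IsScalarTower k A O]

theorem isHopfModule_comul {i : A →ₐc[k] O} (hi : ∀ a, i a = algebraMap A O a) :
    IsHopfModule (i : A →ₗ[k] O) (Coalgebra.comul (R := k) (A := O)) where
  comod :=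
    { coassoc := fun x => Coalgebra.coassoc_apply x
      counit := fun x => by
        refine (congrArg _ (Coalgebra.lTensor_counit_comul x)).trans ?_
        simp }
  smul a x := by
    have h : ∀ (y : A ⊗[k] A) (z : O ⊗[k] O), tensorAct (i : A →ₗ[k] O) y z =
        TensorProduct.map (i : A →ₗ[k] O) (i : A →ₗ[k] O) y * z := by
      intro y z
      induction y using TensorProduct.induction_on with
      | zero => simp
      | add x y hx hy => simp only [map_add, LinearMap.add_apply, add_mul, hx, hy]
      | tmul a b =>
        induction z using TensorProduct.induction_on with
        | zero => simp
        | add x y hx hy => simp only [map_add, mul_add, hx, hy]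
        | tmul n x => simp [Algebra.smul_def, hi]
    rw [h, Algebra.smul_def, ← hi, Bialgebra.comul_mul]
    exact congrArg (· * _) (CoalgHomClass.map_comp_comul_apply i a).symm

theorem exists_comp_eq {X Y Z : Type} [AddCommGroup X] [Module k X] [AddCommGroup Y] [Module k Y]
    [AddCommGroup Z] [Module k Z] (f : X →ₗ[k] Y) (hf : Function.Surjective f) (g : X →ₗ[k] Z)
    (h : LinearMap.ker f ≤ LinearMap.ker g) : ∃ g' : Y →ₗ[k] Z, g' ∘ₗ f = g := by
  obtain ⟨s, hs⟩ := LinearMap.exists_rightInverse_of_surjective f (LinearMap.range_eq_top.2 hf)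
  refine ⟨g ∘ₗ s, LinearMap.ext fun x => ?_⟩
  have hx : s (f x) - x ∈ LinearMap.ker f := by
    rw [LinearMap.mem_ker, map_sub, sub_eq_zero]
    exact LinearMap.congr_fun hs (f x)
  exact sub_eq_zero.1 ((map_sub g _ _).symm.trans (h hx))

theorem mem_range_of_coinvariant {i : A →ₐc[k] O} (hi : ∀ a, i a = algebraMap A O a)
    (hinj : Function.Injective i) {L : Type} [AddCommGroup L] [Module k L] {q : O →ₗ[k] L}
    (hq : Function.Surjective q) (hker : LinearMap.ker q ≤ augSpan k A O) {x : O}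
    (hx : LinearMap.rTensor O q (Coalgebra.comul x) = q 1 ⊗ₜ x) :
    x ∈ LinearMap.range (Algebra.linearMap A O) := by
  set π : O →ₗ[A] O ⧸ LinearMap.range (Algebra.linearMap A O) := Submodule.mkQ _ with hπ
  have hπ0 : ∀ a : A, π (algebraMap A O a) = 0 := fun a => by
    rw [hπ, Submodule.mkQ_apply, Submodule.Quotient.mk_eq_zero]
    exact ⟨a, rfl⟩
  have hsurj : Function.Surjective π := Submodule.mkQ_surjective _
  have hO := isHopfModule_comul hi
  obtain ⟨ρ, hρ⟩ := exists_comp_eq (π.restrictScalars k) hsurj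
    (LinearMap.rTensor O (π.restrictScalars k) ∘ₗ Coalgebra.comul) (by
      intro y hy
      obtain ⟨a, rfl⟩ := (Submodule.Quotient.mk_eq_zero _).1 hy
      rw [LinearMap.mem_ker, LinearMap.comp_apply, Algebra.linearMap_apply, ← hi]
      refine (congrArg _ (CoalgHomClass.map_comp_comul_apply i a).symm).trans ?_
      induction Coalgebra.comul (R := k) a using TensorProduct.induction_on with
      | zero => simp
      | add x y hx hy => simp only [map_add, hx, hy, add_zero]
      | tmul b c => simp [hi, hπ0])
  have hρ' : ∀ n, LinearMap.rTensor O (π.restrictScalars k) (Coalgebra.comul (R := k) n) =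
      ρ (π n) := fun n => (LinearMap.congr_fun hρ n).symm
  have hQ := hO.of_surjective π hsurj hρ'
  obtain ⟨p, hp⟩ := exists_comp_eq q hq
    ((augSpan k A (O ⧸ LinearMap.range (Algebra.linearMap A O))).mkQ ∘ₗ π.restrictScalars k) (by
    refine hker.trans (Submodule.span_le.2 ?_)
    rintro y ⟨a, n, ha, rfl⟩
    simp only [SetLike.mem_coe, LinearMap.mem_ker, LinearMap.comp_apply,
      LinearMap.restrictScalars_apply, map_smul]
    rw [mkQ_augSpan_smul, ha, zero_smul])
  have hp1 : p (q 1) = 0 := by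
    refine (LinearMap.congr_fun hp 1).trans ?_
    have h1 : π 1 = 0 := by simpa using hπ0 1
    simp [h1]
  have hzero : toCoinv A ρ (π x) = 0 := by
    rw [toCoinv, LinearMap.comp_apply, LinearMap.comp_apply, ← hρ', ← LinearMap.rTensor_comp_apply,
      ← hp, LinearMap.rTensor_comp_apply, hx, LinearMap.rTensor_tmul, hp1]
    simp
  exact (Submodule.Quotient.mk_eq_zero _).1
    ((injective_iff_map_eq_zero _).1 (toCoinv_injective hinj hQ) _ hzero)

end Coinvariants

section HopfSub

variable {k : Type} [Field k] {O : Type} [CommRing O] [HopfAlgebra k O] {A : Subalgebra k O}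
variable {L : Type} [CommRing L] [HopfAlgebra k L] {q : O →ₐc[k] L}

theorem IsHopfSub.mem_of_coinvariant (hA : IsHopfSub k O A) (hq : IsQuotientHopf k O L A q)
    {x : O} (hx : LinearMap.rTensor O (q : O →ₗ[k] L) (Coalgebra.comul x) = 1 ⊗ₜ x) : x ∈ A := by
  let := hA.hopfAlgebra
  have hker : LinearMap.ker (q : O →ₗ[k] L) ≤ augSpan k A O := by
    intro y hy
    replace hy : y ∈ Ideal.span (augSet k O A) := hq.ker ▸ hy
    induction hy using Submodule.span_induction with
    | mem y h => exact Submodule.subset_span ⟨⟨y, h.1⟩, 1, h.2, by simp [Subalgebra.smul_def]⟩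
    | zero => exact zero_mem _
    | add x y _ _ hx hy => exact add_mem hx hy
    | smul c x _ hx =>
      have hle : augSpan k A O ≤ (augSpan k A O).comap (LinearMap.mulLeft k c) := by
        refine Submodule.span_le.2 ?_
        rintro z ⟨a, n, ha, rfl⟩
        exact Submodule.subset_span ⟨a, c * n, ha, mul_smul_comm a c n⟩
      exact hle hx
  obtain ⟨a, rfl⟩ := mem_range_of_coinvariant (i := hA.incl) (fun _ => rfl)
    Subtype.val_injective (q := (q : O →ₗ[k] L)) hq.surj hker
    (hx.trans (congrArg (· ⊗ₜ[k] x) (map_one q).symm))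
  exact a.2

end HopfSub

section Reciprocity

variable {k : Type} [Field k] {O : Type} [CommRing O] [HopfAlgebra k O]
variable {V : Type} [AddCommGroup V] [Module k V] {ρV : V →ₗ[k] V ⊗[k] O}
variable {W : Type} [AddCommGroup W] [Module k W] {ρW : W →ₗ[k] W ⊗[k] O}

/-- The automorphism `w ⊗ a ↦ w₀ ⊗ w₁ a` of `W ⊗ O`. -/
noncomputable abbrev shear (ρW : W →ₗ[k] W ⊗[k] O) : W ⊗[k] O →ₗ[k] W ⊗[k] O :=
  twist ρW (AlgHom.id k O).toLinearMap

theorem freeCoact_shear (hW : IsComod k O ρW) (z : W ⊗[k] O) :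
    freeCoact k O (shear ρW z) =
      TensorProduct.map (shear ρW) LinearMap.id (diagCoact k O ρW z) := by
  have h1 : ∀ (a : O) (z : W ⊗[k] O),
      freeCoact k O (LinearMap.lTensor W (LinearMap.mulRight k a ∘ₗ LinearMap.id) z) =
      (TensorProduct.assoc k W O O).symm (LinearMap.lTensor W
        (LinearMap.mulRight k (Coalgebra.comul (R := k) a))
          (TensorProduct.map LinearMap.id Coalgebra.comul z)) := by
    intro a z
    induction z using TensorProduct.induction_on with
    | zero => simp
    | add x y hx hy => simp only [map_add, hx, hy]
    | tmul u x => simp [freeCoact, LinearMap.mulRight_apply]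
  have h2 : ∀ (y z), TensorProduct.map (shear ρW) LinearMap.id
      (TensorProduct.map LinearMap.id (LinearMap.mul' k O)
        (TensorProduct.tensorTensorTensorComm k W O O O (z ⊗ₜ y))) =
      (TensorProduct.assoc k W O O).symm (LinearMap.lTensor W (LinearMap.mulRight k y)
          (TensorProduct.assoc k W O O (TensorProduct.map ρW LinearMap.id z))) := by
    intro y z
    induction z using TensorProduct.induction_on with
    | zero => simp
    | add x z hx hz => simp only [map_add, TensorProduct.add_tmul, hx, hz]
    | tmul u x =>
      induction y using TensorProduct.induction_on with
      | zero => simp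
      | add y z hy hz =>
        have : LinearMap.mulRight k (y + z) = LinearMap.mulRight k y + LinearMap.mulRight k z :=
          LinearMap.ext fun _ => mul_add _ _ _
        simp only [map_add, TensorProduct.tmul_add, hy, hz, this, LinearMap.lTensor_add,
          LinearMap.add_apply]
      | tmul a b =>
        simp only [TensorProduct.tensorTensorTensorComm_tmul, TensorProduct.map_tmul,
          LinearMap.id_apply, LinearMap.mul'_apply, twist_tmul]
        induction ρW u using TensorProduct.induction_on with
        | zero => simp
        | add x y hx hy => simp only [map_add, TensorProduct.add_tmul, hx, hy]
        | tmul u c => simp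
  induction z using TensorProduct.induction_on with
  | zero => simp
  | add x y hx hy => simp only [map_add, hx, hy]
  | tmul w a =>
    refine (congrArg _ (twist_tmul _ _ _ _)).trans ?_
    refine (h1 a _).trans (Eq.trans ?_ (h2 _ _).symm)
    rw [hW.coassoc]

theorem counitMap_shear (hW : IsComod k O ρW) (z : W ⊗[k] O) :
    counitMap k O (shear ρW z) = counitMap k O z := by
  have h : ∀ (a : O) (z : W ⊗[k] O),
      counitMap k O (LinearMap.lTensor W (LinearMap.mulRight k a ∘ₗ LinearMap.id) z) =
        Coalgebra.counit (R := k) a • counitMap k O z := by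
    intro a z
    induction z using TensorProduct.induction_on with
    | zero => simp
    | add x y hx hy => simp only [map_add, smul_add, hx, hy]
    | tmul u x => simp [counitMap, smul_smul, mul_comm]
  induction z using TensorProduct.induction_on with
  | zero => simp
  | add x y hx hy => simp only [map_add, hx, hy]
  | tmul w a =>
    refine (congrArg _ (twist_tmul _ _ _ _)).trans ((h a _).trans ?_)
    have h' : counitMap k O (ρW w) = w := hW.counit w
    rw [h']
    simp [counitMap]

theorem eq_map_counitMap_of_freeCoact {G : V →ₗ[k] W ⊗[k] O}
    (hG : ∀ v, freeCoact k O (G v) = TensorProduct.map G LinearMap.id (ρV v)) (v : V) :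
    G v = LinearMap.rTensor O (counitMap k O ∘ₗ G) (ρV v) := by
  have h : ∀ z : W ⊗[k] O, LinearMap.rTensor O (counitMap k O) (freeCoact k O z) = z := by
    intro z
    induction z using TensorProduct.induction_on with
    | zero => simp
    | add x y hx hy => simp only [map_add, hx, hy]
    | tmul w a =>
      have ha : ∀ y : O ⊗[k] O,
          LinearMap.rTensor O (counitMap k O) ((TensorProduct.assoc k W O O).symm (w ⊗ₜ y)) =
          w ⊗ₜ TensorProduct.lid k O (LinearMap.rTensor O Coalgebra.counit y) := by
        intro y
        induction y using TensorProduct.induction_on with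
        | zero => simp
        | add x y hx hy => simp only [map_add, TensorProduct.tmul_add, hx, hy]
        | tmul b c => simp [counitMap, TensorProduct.smul_tmul]
      refine (ha _).trans ?_
      rw [Coalgebra.rTensor_counit_comul]
      simp
  rw [LinearMap.rTensor_comp_apply, ← h (G v), hG]
  rfl

theorem freeCoact_map (hV : IsComod k O ρV) (f : V →ₗ[k] W) (v : V) :
    freeCoact k O (LinearMap.rTensor O f (ρV v)) =
      TensorProduct.map (LinearMap.rTensor O f ∘ₗ ρV) LinearMap.id (ρV v) := by
  have h1 : ∀ z : V ⊗[k] O, freeCoact k O (LinearMap.rTensor O f z) =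
      LinearMap.rTensor O (LinearMap.rTensor O f) ((TensorProduct.assoc k V O O).symm
        (TensorProduct.map LinearMap.id (Coalgebra.comul (R := k)) z)) := by
    intro z
    induction z using TensorProduct.induction_on with
    | zero => simp
    | add x y hx hy => simp only [map_add, hx, hy]
    | tmul w a =>
      simp only [freeCoact, LinearMap.rTensor_tmul, LinearMap.comp_apply, LinearMap.lTensor_tmul,
        LinearEquiv.coe_coe, TensorProduct.map_tmul, LinearMap.id_apply]
      induction Coalgebra.comul (R := k) a using TensorProduct.induction_on with
      | zero => simp
      | add x y hx hy => simp only [map_add, TensorProduct.tmul_add, hx, hy]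
      | tmul b c => simp
  rw [h1, ← hV.coassoc, LinearEquiv.symm_apply_apply]
  exact (LinearMap.rTensor_comp_apply O _ _ _).symm

theorem counitMap_rTensor (hV : IsComod k O ρV) (f : V →ₗ[k] W) (v : V) :
    counitMap k O (LinearMap.rTensor O f (ρV v)) = f v := by
  have h : ∀ z : V ⊗[k] O, counitMap k O (LinearMap.rTensor O f z) = f (counitMap k O z) := by
    intro z
    induction z using TensorProduct.induction_on with
    | zero => simp
    | add x y hx hy => simp only [map_add, hx, hy]
    | tmul w a => simp [counitMap]
  rw [h]
  exact congrArg f (hV.counit v)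

theorem shear_apply_of_isColinear (hW : IsComod k O ρW) {F : V →ₗ[k] W ⊗[k] O}
    (hF : IsColinear k O ρV (diagCoact k O ρW) F) (v : V) :
    shear ρW (F v) = LinearMap.rTensor O (counitMap k O ∘ₗ F) (ρV v) := by
  have hG : ∀ v, freeCoact k O ((shear ρW ∘ₗ F) v) =
      TensorProduct.map (shear ρW ∘ₗ F) LinearMap.id (ρV v) := by
    intro v
    rw [LinearMap.comp_apply, freeCoact_shear hW, hF v]
    exact (LinearMap.rTensor_comp_apply O _ _ _).symm
  have hc : counitMap k O ∘ₗ shear ρW ∘ₗ F = counitMap k O ∘ₗ F :=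
    LinearMap.ext fun v => counitMap_shear hW (F v)
  have h := eq_map_counitMap_of_freeCoact hG v
  rwa [hc] at h

theorem isColinear_of_shear (hV : IsComod k O ρV) (hW : IsComod k O ρW) {f : V →ₗ[k] W}
    {F : V →ₗ[k] W ⊗[k] O} (hF : ∀ v, shear ρW (F v) = LinearMap.rTensor O f (ρV v)) :
    IsColinear k O ρV (diagCoact k O ρW) F := by
  intro v
  refine Module.Flat.rTensor_preserves_injective_linearMap (M := O) (shear ρW)
    (twist_injective hW _) ?_
  have hc : shear ρW ∘ₗ F = LinearMap.rTensor O f ∘ₗ ρV := LinearMap.ext hF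
  refine (freeCoact_shear hW _).symm.trans ?_
  rw [hF, freeCoact_map hV, ← hc]
  exact LinearMap.rTensor_comp_apply O _ _ _

theorem counitMap_of_shear (hV : IsComod k O ρV) (hW : IsComod k O ρW) {f : V →ₗ[k] W}
    {F : V →ₗ[k] W ⊗[k] O} (hF : ∀ v, shear ρW (F v) = LinearMap.rTensor O f (ρV v)) :
    counitMap k O ∘ₗ F = f :=
  LinearMap.ext fun v => by
    rw [LinearMap.comp_apply, ← counitMap_shear hW, hF, counitMap_rTensor hV]

variable {L : Type} [CommRing L] [HopfAlgebra k L] {q : O →ₐc[k] L} {A : Subalgebra k O}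

theorem IsQuotientHopf.apply_mem (hq : IsQuotientHopf k O L A q) {a : O} (ha : a ∈ A) :
    q a = algebraMap k L (Coalgebra.counit a) := by
  have h : a - algebraMap k O (Coalgebra.counit a) ∈ RingHom.ker (q : O →ₐ[k] L) := by
    rw [hq.ker]
    exact Ideal.subset_span ⟨sub_mem ha (A.algebraMap_mem _), by simp⟩
  have h' := sub_eq_zero.1 ((map_sub (q : O →ₐ[k] L) _ _).symm.trans h)
  exact h'.trans (AlgHomClass.commutes (q : O →ₐ[k] L) _)

theorem resCoact_counitMap (hq : IsQuotientHopf k O L A q) {z : W ⊗[k] O}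
    (hz : z ∈ LinearMap.range (LinearMap.lTensor W A.toSubmodule.subtype)) :
    resCoact k O L q ρW (counitMap k O z) =
      LinearMap.lTensor W (q : O →ₗ[k] L) (shear ρW z) := by
  obtain ⟨z, rfl⟩ := hz
  induction z using TensorProduct.induction_on with
  | zero => simp
  | add x y hx hy => simp only [map_add, hx, hy]
  | tmul w a =>
    rw [LinearMap.lTensor_tmul, twist_tmul, ← LinearMap.lTensor_comp_apply]
    have h : (q : O →ₗ[k] L) ∘ₗ LinearMap.mulRight k (a : O) ∘ₗ (AlgHom.id k O).toLinearMap =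
        Coalgebra.counit (R := k) (a : O) • (q : O →ₗ[k] L) := by
      ext x
      refine (map_mul q x a).trans ?_
      rw [hq.apply_mem a.2, mul_comm, ← Algebra.smul_def]
      rfl
    refine Eq.trans ?_ (congrArg (fun g => LinearMap.lTensor W g (ρW w)) h).symm
    simp [counitMap, resCoact, LinearMap.lTensor_smul]

theorem isColinear_counitMap_comp (hq : IsQuotientHopf k O L A q) (hW : IsComod k O ρW)
    {F : V →ₗ[k] W ⊗[k] O} (hF : IsColinear k O ρV (diagCoact k O ρW) F)
    (hr : LinearMap.range F ≤ LinearMap.range (LinearMap.lTensor W A.toSubmodule.subtype)) :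
    IsColinear k L (resCoact k O L q ρV) (resCoact k O L q ρW) (counitMap k O ∘ₗ F) := by
  intro v
  rw [LinearMap.comp_apply, resCoact_counitMap hq (hr ⟨v, rfl⟩), shear_apply_of_isColinear hW hF,
    resCoact, LinearMap.comp_apply]
  induction ρV v using TensorProduct.induction_on with
  | zero => simp
  | add x y hx hy => simp only [map_add, hx, hy]
  | tmul v x => simp

/-- The algebra map `(q ⊗ id) ∘ Δ : O → L ⊗ O`. -/
noncomputable def leftRes (q : O →ₐc[k] L) : O →ₐ[k] L ⊗[k] O :=
  (Algebra.TensorProduct.map (q : O →ₐ[k] L) (AlgHom.id k O)).comp (Bialgebra.comulAlgHom k O)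

theorem twist_lTensor_leftRes (q : O →ₐc[k] L) (z : W ⊗[k] O) :
    twist ρW (leftRes q).toLinearMap (LinearMap.lTensor W (leftRes q).toLinearMap z) =
      LinearMap.lTensor W (leftRes q).toLinearMap (shear ρW z) := by
  induction z using TensorProduct.induction_on with
  | zero => simp
  | add x y hx hy => simp only [map_add, hx, hy]
  | tmul w a =>
    rw [LinearMap.lTensor_tmul, twist_tmul, twist_tmul, ← LinearMap.lTensor_comp_apply]
    congr 2
    ext x
    simp

theorem twist_lTensor_includeRight (q : O →ₐc[k] L) (hW : IsComod k O ρW) (z : W ⊗[k] O) :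
    twist ρW (leftRes q).toLinearMap
        (LinearMap.lTensor W
          (Algebra.TensorProduct.includeRight : O →ₐ[k] L ⊗[k] O).toLinearMap z) =
      TensorProduct.assoc k W L O (LinearMap.rTensor O (resCoact k O L q ρW) (shear ρW z)) := by
  have h1 : ∀ (a : O) (z : W ⊗[k] O), LinearMap.lTensor W
      (LinearMap.mulRight k ((1 : L) ⊗ₜ[k] a) ∘ₗ (leftRes q).toLinearMap) z =
      LinearMap.lTensor W (LinearMap.mulRight k ((1 : L) ⊗ₜ[k] a) ∘ₗ
        TensorProduct.map (q : O →ₗ[k] L) LinearMap.id)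
        (TensorProduct.map LinearMap.id Coalgebra.comul z) := by
    intro a z
    induction z using TensorProduct.induction_on with
    | zero => simp
    | add x y hx hy => simp only [map_add, hx, hy]
    | tmul w x => rfl
  have h2 : ∀ (a : O) (z : W ⊗[k] O),
      TensorProduct.assoc k W L O (LinearMap.rTensor O (resCoact k O L q ρW)
        (LinearMap.lTensor W (LinearMap.mulRight k a ∘ₗ LinearMap.id) z)) =
      LinearMap.lTensor W (LinearMap.mulRight k ((1 : L) ⊗ₜ[k] a) ∘ₗ
        TensorProduct.map (q : O →ₗ[k] L) LinearMap.id)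
        (TensorProduct.assoc k W O O (TensorProduct.map ρW LinearMap.id z)) := by
    intro a z
    induction z using TensorProduct.induction_on with
    | zero => simp
    | add x y hx hy => simp only [map_add, hx, hy]
    | tmul w x =>
      simp only [LinearMap.lTensor_tmul, LinearMap.rTensor_tmul, TensorProduct.map_tmul, resCoact,
        LinearMap.comp_apply, LinearMap.id_apply]
      induction ρW w using TensorProduct.induction_on with
      | zero => simp
      | add x y hx hy => simp only [map_add, TensorProduct.add_tmul, hx, hy]
      | tmul u c => simp
  induction z using TensorProduct.induction_on with
  | zero => simp
  | add x y hx hy => simp only [map_add, hx, hy]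
  | tmul w a =>
    refine Eq.trans ?_ (congrArg (fun y => TensorProduct.assoc k W L O
      (LinearMap.rTensor O (resCoact k O L q ρW) y)) (twist_tmul _ _ _ _)).symm
    refine Eq.trans ?_ (h2 a _).symm
    rw [hW.coassoc, ← h1, LinearMap.lTensor_tmul, twist_tmul]
    rfl

theorem assoc_rTensor_resCoact (hV : IsComod k O ρV) {f : V →ₗ[k] W}
    (hf : IsColinear k L (resCoact k O L q ρV) (resCoact k O L q ρW) f) (v : V) :
    TensorProduct.assoc k W L O
        (LinearMap.rTensor O (resCoact k O L q ρW) (LinearMap.rTensor O f (ρV v))) =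
      LinearMap.lTensor W (leftRes q).toLinearMap (LinearMap.rTensor O f (ρV v)) := by
  have hf' : resCoact k O L q ρW ∘ₗ f = LinearMap.rTensor L f ∘ₗ resCoact k O L q ρV :=
    LinearMap.ext hf
  have h1 : ∀ z : V ⊗[k] O, TensorProduct.assoc k W L O
      (LinearMap.rTensor O (LinearMap.rTensor L f ∘ₗ resCoact k O L q ρV) z) =
      TensorProduct.map f (TensorProduct.map (q : O →ₗ[k] L) LinearMap.id)
        (TensorProduct.assoc k V O O (TensorProduct.map ρV LinearMap.id z)) := by
    intro z
    induction z using TensorProduct.induction_on with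
    | zero => simp
    | add x y hx hy => simp only [map_add, hx, hy]
    | tmul w x =>
      simp only [LinearMap.rTensor_tmul, TensorProduct.map_tmul, resCoact,
        LinearMap.comp_apply, LinearMap.id_apply]
      induction ρV w using TensorProduct.induction_on with
      | zero => simp
      | add x y hx hy => simp only [map_add, TensorProduct.add_tmul, hx, hy]
      | tmul u c => simp
  rw [← LinearMap.rTensor_comp_apply, hf', h1, hV.coassoc]
  induction ρV v using TensorProduct.induction_on with
  | zero => simp
  | add x y hx hy => simp only [map_add, hx, hy]
  | tmul w x => rfl

theorem mem_range_of_shear (hA : IsHopfSub k O A) (hq : IsQuotientHopf k O L A q)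
    (hV : IsComod k O ρV) (hW : IsComod k O ρW) {f : V →ₗ[k] W}
    (hf : IsColinear k L (resCoact k O L q ρV) (resCoact k O L q ρW) f)
    {F : V →ₗ[k] W ⊗[k] O} (hF : ∀ v, shear ρW (F v) = LinearMap.rTensor O f (ρV v)) :
    LinearMap.range F ≤ LinearMap.range (LinearMap.lTensor W A.toSubmodule.subtype) := by
  rintro _ ⟨v, rfl⟩
  set θ : O →ₗ[k] L ⊗[k] O := (leftRes q).toLinearMap -
    (Algebra.TensorProduct.includeRight : O →ₐ[k] L ⊗[k] O).toLinearMap with hθ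
  have hexact : Function.Exact A.toSubmodule.subtype θ := by
    intro x
    rw [hθ, LinearMap.sub_apply, sub_eq_zero]
    constructor
    · intro hx
      exact ⟨⟨x, hA.mem_of_coinvariant hq hx⟩, rfl⟩
    · rintro ⟨a, rfl⟩
      have h : ∀ y ∈ Submodule.span k {x : O ⊗[k] O | ∃ b ∈ A, ∃ c ∈ A, x = b ⊗ₜ[k] c},
          LinearMap.rTensor O (q : O →ₗ[k] L) y =
            1 ⊗ₜ TensorProduct.lid k O (LinearMap.rTensor O Coalgebra.counit y) := by
        intro y hy
        induction hy using Submodule.span_induction with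
        | mem y hy =>
          obtain ⟨b, hb, c, hc, rfl⟩ := hy
          have hqb : (q : O →ₗ[k] L) b = _ := hq.apply_mem hb
          rw [LinearMap.rTensor_tmul, hqb, Algebra.algebraMap_eq_smul_one]
          simp [TensorProduct.smul_tmul]
        | zero => simp
        | add x y _ _ hx hy => simp only [map_add, TensorProduct.tmul_add, hx, hy]
        | smul c x _ hx => simp only [map_smul, TensorProduct.tmul_smul, hx]
      refine (h _ (hA.comul_mem a a.2)).trans ?_
      rw [Coalgebra.rTensor_counit_comul]
      simp
  refine (Module.Flat.lTensor_exact W hexact _).1 ?_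
  rw [hθ, LinearMap.lTensor_sub, LinearMap.sub_apply, sub_eq_zero]
  refine twist_injective hW (leftRes q) ?_
  rw [twist_lTensor_leftRes, twist_lTensor_includeRight q hW, hF, assoc_rTensor_resCoact hV hf]

theorem existsUnique_isColinear (hA : IsHopfSub k O A) (hq : IsQuotientHopf k O L A q)
    (hV : IsComod k O ρV) (hW : IsComod k O ρW) {f : V →ₗ[k] W}
    (hf : IsColinear k L (resCoact k O L q ρV) (resCoact k O L q ρW) f) :
    ∃! F : V →ₗ[k] W ⊗[k] O, IsColinear k O ρV (diagCoact k O ρW) F ∧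
      LinearMap.range F ≤ LinearMap.range (LinearMap.lTensor W A.toSubmodule.subtype) ∧
      counitMap k O ∘ₗ F = f := by
  have hF : ∀ v, shear ρW ((twist ρW ((AlgHom.id k O).toLinearMap ∘ₗ HopfAlgebra.antipode k) ∘ₗ
      LinearMap.rTensor O f ∘ₗ ρV) v) = LinearMap.rTensor O f (ρV v) :=
    fun v => twist_twist_antipode hW (AlgHom.id k O) _
  refine ⟨_, ⟨isColinear_of_shear hV hW hF, mem_range_of_shear hA hq hV hW hf hF,
    counitMap_of_shear hV hW hF⟩, ?_⟩
  rintro F ⟨hcol, -, rfl⟩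
  refine LinearMap.ext fun v => twist_injective hW (AlgHom.id k O) ?_
  exact (shear_apply_of_isColinear hW hcol v).trans (hF v).symm

variable {W' : Type} [AddCommGroup W'] [Module k W'] {ρW' : W' →ₗ[k] W' ⊗[k] O}

theorem isColinear_rTensor_diagCoact {u : W →ₗ[k] W'} (hu : IsColinear k O ρW ρW' u) :
    IsColinear k O (diagCoact k O ρW) (diagCoact k O ρW') (LinearMap.rTensor O u) := by
  have h : ∀ (z : W ⊗[k] O) (y : O ⊗[k] O),
      TensorProduct.map LinearMap.id (LinearMap.mul' k O)
        (TensorProduct.tensorTensorTensorComm k W' O O O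
          (TensorProduct.map u LinearMap.id z ⊗ₜ y)) =
      TensorProduct.map (LinearMap.rTensor O u) LinearMap.id
        (TensorProduct.map LinearMap.id (LinearMap.mul' k O)
          (TensorProduct.tensorTensorTensorComm k W O O O (z ⊗ₜ y))) := by
    intro z y
    induction z using TensorProduct.induction_on with
    | zero => simp
    | add x z hx hz => simp only [map_add, TensorProduct.add_tmul, hx, hz]
    | tmul w x =>
      induction y using TensorProduct.induction_on with
      | zero => simp
      | add y z hy hz => simp only [map_add, TensorProduct.tmul_add, hy, hz]
      | tmul a b => simp
  intro z
  induction z using TensorProduct.induction_on with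
  | zero => simp
  | add x y hx hy => simp only [map_add, hx, hy]
  | tmul w a =>
    refine Eq.trans ?_ (h (ρW w) (Coalgebra.comul a))
    rw [← hu w]
    rfl

theorem counitMap_comp_rTensor (u : W →ₗ[k] W') :
    counitMap k O ∘ₗ LinearMap.rTensor O u = u ∘ₗ counitMap k O := by
  ext w a
  simp [counitMap]

end Reciprocity

end PaperQuotient

open PaperQuotient in
/-- For right `O`-comodules `V, W`, the assignment
`F ↦ (id_W ⊗ ε) ∘ F` is a bijection from the `O`-colinear maps `V → W ⊗ A`
(with the diagonal coaction on `W ⊗ A ⊆ W ⊗ O`) onto the `L`-colinear maps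
`V → W`, natural in `V` and `W`. -/
theorem statement9
    (k : Type) [Field k] (O : Type) [CommRing O] [HopfAlgebra k O]
    (A : Subalgebra k O) (hA : IsHopfSub k O A)
    (L : Type) [CommRing L] [HopfAlgebra k L]
    (q : O →ₐc[k] L) (hq : IsQuotientHopf k O L A q)
    (V : Type) [AddCommGroup V] [Module k V]
    (ρV : V →ₗ[k] V ⊗[k] O) (hV : IsComod k O ρV)
    (W : Type) [AddCommGroup W] [Module k W]
    (ρW : W →ₗ[k] W ⊗[k] O) (hW : IsComod k O ρW) :
    -- the assignment is well defined: `(id ⊗ ε) ∘ F` is `L`-colinear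
    (∀ F : V →ₗ[k] W ⊗[k] O,
        IsColinear k O ρV (diagCoact k O ρW) F →
        LinearMap.range F ≤ LinearMap.range (LinearMap.lTensor W A.toSubmodule.subtype) →
        IsColinear k L (resCoact k O L q ρV) (resCoact k O L q ρW)
          ((counitMap k O) ∘ₗ F)) ∧
    -- it is a bijection onto the `L`-colinear maps `V → W`
    (∀ f : V →ₗ[k] W,
        IsColinear k L (resCoact k O L q ρV) (resCoact k O L q ρW) f →
        ∃! F : V →ₗ[k] W ⊗[k] O,
          IsColinear k O ρV (diagCoact k O ρW) F ∧
          LinearMap.range F ≤ LinearMap.range (LinearMap.lTensor W A.toSubmodule.subtype) ∧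
          (counitMap k O) ∘ₗ F = f) ∧
    -- naturality in `V`
    (∀ (V' : Comod k O) (g : V'.carrier →ₗ[k] V), IsColinear k O V'.ρ ρV g →
        ∀ F : V →ₗ[k] W ⊗[k] O,
          (counitMap k O) ∘ₗ (F ∘ₗ g) = ((counitMap k O) ∘ₗ F) ∘ₗ g) ∧
    -- naturality in `W`
    (∀ (W' : Comod k O) (u : W →ₗ[k] W'.carrier), IsColinear k O ρW W'.ρ u →
        ∀ F : V →ₗ[k] W ⊗[k] O,
          IsColinear k O ρV (diagCoact k O ρW) F →
          LinearMap.range F ≤ LinearMap.range (LinearMap.lTensor W A.toSubmodule.subtype) →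
          IsColinear k O ρV (diagCoact k O W'.ρ) ((LinearMap.rTensor O u) ∘ₗ F) ∧
          LinearMap.range ((LinearMap.rTensor O u) ∘ₗ F) ≤
            LinearMap.range (LinearMap.lTensor W'.carrier A.toSubmodule.subtype) ∧
          (counitMap k O) ∘ₗ ((LinearMap.rTensor O u) ∘ₗ F) =
            u ∘ₗ ((counitMap k O) ∘ₗ F)) := by
  refine ⟨fun F hF hr => isColinear_counitMap_comp hq hW hF hr,
    fun f hf => existsUnique_isColinear hA hq hV hW hf, fun V' g _ F => rfl,
    fun W' u hu F hF hr => ⟨fun v => ?_, ?_, ?_⟩⟩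
  · rw [LinearMap.comp_apply, isColinear_rTensor_diagCoact hu, hF v]
    exact (LinearMap.rTensor_comp_apply O _ _ _).symm
  · rintro _ ⟨v, rfl⟩
    obtain ⟨z, hz⟩ := hr ⟨v, rfl⟩
    refine ⟨LinearMap.rTensor A u z, ?_⟩
    rw [LinearMap.comp_apply, ← hz]
    exact (LinearMap.congr_fun (LinearMap.lTensor_comp_rTensor _ u _) z).trans
      (LinearMap.congr_fun (LinearMap.rTensor_comp_lTensor _ u _) z).symm
  · rw [← LinearMap.comp_assoc, counitMap_comp_rTensor, LinearMap.comp_assoc]
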